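/- arXiv:2108.11162 — 3 statements merged into one kernel-verified Lean document; each statement's English description precedes it below -/
import Mathlib

section
/- Let Φ: ℝ⁴ → ℂ be a Schwartz-class function, M, T ≥ 1, and for (a₁,a₂,b₁,b₂) ∈ ℝ⁴ define ℋ(a,b) = ∫_{ℝ²} e((Tu/2)(a₁b₂ + a₂b₁) + (z/(4M²))(a₁+a₂)(b₁+b₂)) · Φ(Tu·b₁b₂ + (z/(4M²))(b₁+b₂)², Tu·a₁a₂ + (z/(4M²))(a₁+a₂)², z, u) du dz, where e(x) = e^{2πix}. Then for every A > 0 and all (a₁,a₂,b₁,b₂) ∈ ℝ⁴, |ℋ(a,b)| ≪_{A,Φ} (T(|a₁a₂| + |b₁b₂|) + 1)^{−1} · (1 + |a₁b₂ + a₂b₁|/(|a₁a₂| + |b₁b₂| + 1/T))^{−A}; in particular |ℋ(a,b)| ≪_Φ 1/(T·max(|a₁a₂|, |b₁b₂|, |a₁b₂ + a₂b₁|) + 1). -/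
open MeasureTheory
open scoped SchwartzMap

noncomputable section

/-- The oscillatory integral `ℋ(a,b)` attached to a Schwartz function `Φ` on `ℝ⁴`:
`ℋ(a,b) = ∫∫ e((Tu/2)(a₁b₂+a₂b₁) + (z/4M²)(a₁+a₂)(b₁+b₂)) ·
  Φ(Tu·b₁b₂ + (z/4M²)(b₁+b₂)², Tu·a₁a₂ + (z/4M²)(a₁+a₂)², z, u) du dz`,
where `e(x) = e^{2πix}`. -/
def Hosc (Φ : 𝓢(ℝ × ℝ × ℝ × ℝ, ℂ)) (M T : ℝ) (a₁ a₂ b₁ b₂ : ℝ) : ℂ :=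
  ∫ z : ℝ, ∫ u : ℝ,
    Complex.exp (2 * Real.pi * Complex.I *
      (T * u / 2 * (a₁ * b₂ + a₂ * b₁) + z / (4 * M ^ 2) * ((a₁ + a₂) * (b₁ + b₂)))) *
    Φ (T * u * (b₁ * b₂) + z / (4 * M ^ 2) * (b₁ + b₂) ^ 2,
       T * u * (a₁ * a₂) + z / (4 * M ^ 2) * (a₁ + a₂) ^ 2, z, u)

end

open scoped LineDeriv

/-- A Schwartz function decays quadratically in any two quantities controlled by the norm. -/
lemma SchwartzMap.exists_norm_le_inv_mul_inv {E V : Type*} [NormedAddCommGroup E]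
    [NormedSpace ℝ E] [NormedAddCommGroup V] [NormedSpace ℝ V] (F : 𝓢(E, V)) :
    ∃ C : ℝ, 0 ≤ C ∧ ∀ (x : E) (s t : ℝ), |s| ≤ ‖x‖ → |t| ≤ ‖x‖ →
      ‖F x‖ ≤ C * (1 + s ^ 2)⁻¹ * (1 + t ^ 2)⁻¹ := by
  obtain ⟨C₀, h₀, H₀⟩ := F.decay 0 0
  obtain ⟨C₄, h₄, H₄⟩ := F.decay 4 0
  refine ⟨2 * (C₀ + C₄), by positivity, fun x s t hs ht => ?_⟩
  have H₀x := H₀ x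
  have H₄x := H₄ x
  simp only [norm_iteratedFDeriv_zero, pow_zero, one_mul] at H₀x H₄x
  have hs2 : s ^ 2 ≤ ‖x‖ ^ 2 := sq_le_sq' (by linarith [neg_abs_le s]) ((le_abs_self s).trans hs)
  have ht2 : t ^ 2 ≤ ‖x‖ ^ 2 := sq_le_sq' (by linarith [neg_abs_le t]) ((le_abs_self t).trans ht)
  rw [mul_assoc, ← mul_inv, ← div_eq_mul_inv, le_div_iff₀ (by positivity)]
  calc ‖F x‖ * ((1 + s ^ 2) * (1 + t ^ 2))
      ≤ ‖F x‖ * ((1 + ‖x‖ ^ 2) * (1 + ‖x‖ ^ 2)) := by gcongr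
    _ ≤ ‖F x‖ * (2 * (1 + ‖x‖ ^ 4)) := by
        refine mul_le_mul_of_nonneg_left ?_ (norm_nonneg _)
        nlinarith [sq_nonneg (‖x‖ ^ 2 - 1)]
    _ ≤ 2 * (C₀ + C₄) := by linarith

lemma integrable_inv_one_add_sq_comp_affine {p : ℝ} (hp : p ≠ 0) (s : ℝ) :
    Integrable fun u : ℝ => (1 + (p * u + s) ^ 2)⁻¹ :=
  (integrable_inv_one_add_sq.comp_add_right s).comp_mul_left' hp

lemma integral_inv_one_add_sq_comp_affine (p s : ℝ) :
    ∫ u : ℝ, (1 + (p * u + s) ^ 2)⁻¹ = |p|⁻¹ * Real.pi := by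
  rw [Measure.integral_comp_mul_left (fun x : ℝ => (1 + (x + s) ^ 2)⁻¹) p,
    integral_add_right_eq_self (fun x : ℝ => (1 + x ^ 2)⁻¹) s,
    integral_univ_inv_one_add_sq, abs_inv, smul_eq_mul]

/-- The Fourier-type integral of a Schwartz function on `ℝ⁴` along the line
`u ↦ (p u + x, q u + y, z, u)`. -/
noncomputable def lineOsc (F : 𝓢(ℝ × ℝ × ℝ × ℝ, ℂ)) (θ δ p q x y z : ℝ) : ℂ :=
  ∫ u : ℝ, Complex.exp (((θ * u + δ : ℝ) : ℂ) * Complex.I) * F (p * u + x, q * u + y, z, u)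

lemma integrable_lineOsc (F : 𝓢(ℝ × ℝ × ℝ × ℝ, ℂ)) (θ δ p q x y z : ℝ) :
    Integrable fun u : ℝ =>
      Complex.exp (((θ * u + δ : ℝ) : ℂ) * Complex.I) * F (p * u + x, q * u + y, z, u) := by
  obtain ⟨C, -, hC⟩ := F.exists_norm_le_inv_mul_inv
  refine (integrable_inv_one_add_sq.const_mul C).mono' ?_ (.of_forall fun u => ?_)
  · have := F.continuous
    exact Continuous.aestronglyMeasurable (by fun_prop)
  · rw [norm_mul, Complex.norm_exp_ofReal_mul_I, one_mul]
    simpa using hC (p * u + x, q * u + y, z, u) 0 u (by simp) (by simp [Prod.norm_def])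

lemma lineOsc_add (F G : 𝓢(ℝ × ℝ × ℝ × ℝ, ℂ)) (θ δ p q x y z : ℝ) :
    lineOsc (F + G) θ δ p q x y z = lineOsc F θ δ p q x y z + lineOsc G θ δ p q x y z := by
  simp only [lineOsc, add_apply, mul_add]
  exact integral_add (integrable_lineOsc F θ δ p q x y z) (integrable_lineOsc G θ δ p q x y z)

lemma lineOsc_smul (c : ℝ) (F : 𝓢(ℝ × ℝ × ℝ × ℝ, ℂ)) (θ δ p q x y z : ℝ) :
    lineOsc (c • F) θ δ p q x y z = c * lineOsc F θ δ p q x y z := by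
  simp only [lineOsc, smul_apply, Complex.real_smul, mul_left_comm _ (c : ℂ)]
  exact integral_const_mul _ _

/-- Integration by parts along the line. -/
lemma lineOsc_mul_eq_neg_lineOsc_lineDeriv (F : 𝓢(ℝ × ℝ × ℝ × ℝ, ℂ)) (θ δ p q x y z : ℝ) :
    θ * Complex.I * lineOsc F θ δ p q x y z =
      -lineOsc (∂_{((p, q, 0, 1) : ℝ × ℝ × ℝ × ℝ)} F) θ δ p q x y z := by
  have hE (u : ℝ) : HasDerivAt
      (fun u : ℝ => Complex.exp (((θ * u + δ : ℝ) : ℂ) * Complex.I))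
      (θ * Complex.I * Complex.exp (((θ * u + δ : ℝ) : ℂ) * Complex.I)) u := by
    have h : HasDerivAt (fun u : ℝ => θ * u + δ) θ u := by
      simpa using ((hasDerivAt_id u).const_mul θ).add_const δ
    simpa [mul_comm] using (h.ofReal_comp.mul_const Complex.I).cexp
  have hF (u : ℝ) : HasDerivAt (fun u : ℝ => F (p * u + x, q * u + y, z, u))
      ((∂_{((p, q, 0, 1) : ℝ × ℝ × ℝ × ℝ)} F) (p * u + x, q * u + y, z, u)) u := by
    have hp : HasDerivAt (fun u : ℝ => p * u + x) p u := by
      simpa using ((hasDerivAt_id u).const_mul p).add_const x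
    have hq : HasDerivAt (fun u : ℝ => q * u + y) q u := by
      simpa using ((hasDerivAt_id u).const_mul q).add_const y
    rw [SchwartzMap.lineDerivOp_apply_eq_fderiv]
    exact F.differentiableAt.hasFDerivAt.comp_hasDerivAt u
      (hp.prodMk (hq.prodMk ((hasDerivAt_const u z).prodMk (hasDerivAt_id u))))
  have key := integral_mul_deriv_eq_deriv_mul_of_integrable
    (fun u _ => hE u) (fun u _ => hF u)
    (integrable_lineOsc _ θ δ p q x y z)
    (by
      simpa only [Pi.mul_def, mul_assoc] using
        (integrable_lineOsc F θ δ p q x y z).const_mul (θ * Complex.I))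
    (integrable_lineOsc F θ δ p q x y z)
  rw [lineOsc, lineOsc, key, neg_neg, ← integral_const_mul]
  simp only [mul_assoc]

lemma norm_lineOsc_mul_abs_le (F : 𝓢(ℝ × ℝ × ℝ × ℝ, ℂ)) (θ δ p q x y z : ℝ) {r s K : ℝ}
    (h : ∀ u : ℝ, ‖F (p * u + x, q * u + y, z, u)‖ ≤ K * (1 + (r * u + s) ^ 2)⁻¹) :
    ‖lineOsc F θ δ p q x y z‖ * |r| ≤ K * Real.pi := by
  have hK : 0 ≤ K := by
    have := (norm_nonneg _).trans (h 0)
    exact nonneg_of_mul_nonneg_left this (by positivity)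
  rcases eq_or_ne r 0 with rfl | hr
  · simpa using mul_nonneg hK Real.pi_nonneg
  · have := norm_integral_le_of_norm_le
      ((integrable_inv_one_add_sq_comp_affine hr s).const_mul K)
      (f := fun u : ℝ => Complex.exp (((θ * u + δ : ℝ) : ℂ) * Complex.I) *
        F (p * u + x, q * u + y, z, u))
      (.of_forall fun u => by
        rw [norm_mul, Complex.norm_exp_ofReal_mul_I, one_mul]
        exact h u)
    rw [integral_const_mul, integral_inv_one_add_sq_comp_affine] at this
    have hr' : 0 < |r| := abs_pos.mpr hr
    calc ‖lineOsc F θ δ p q x y z‖ * |r| ≤ K * (|r|⁻¹ * Real.pi) * |r| := by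
          gcongr
          exact this
      _ = K * Real.pi := by field_simp

/-- Each integration by parts gains a factor `(|p| + |q| + 1) / |θ|`. -/
lemma exists_norm_lineOsc_le (n : ℕ) (F : 𝓢(ℝ × ℝ × ℝ × ℝ, ℂ)) :
    ∃ C : ℝ, 0 ≤ C ∧ ∀ θ δ p q x y z : ℝ,
      ‖lineOsc F θ δ p q x y z‖ * (|p| + |q| + 1) * |θ| ^ n ≤
        C * (|p| + |q| + 1) ^ n * (1 + z ^ 2)⁻¹ := by
  induction n generalizing F with
  | zero =>
    obtain ⟨C, hC₀, hC⟩ := F.exists_norm_le_inv_mul_inv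
    refine ⟨3 * (C * Real.pi), by positivity, fun θ δ p q x y z => ?_⟩
    have h₁ := norm_lineOsc_mul_abs_le F θ δ p q x y z (r := p) (s := x)
      (K := C * (1 + z ^ 2)⁻¹) fun u => hC _ _ _ (by simp [Prod.norm_def]) (by simp [Prod.norm_def])
    have h₂ := norm_lineOsc_mul_abs_le F θ δ p q x y z (r := q) (s := y)
      (K := C * (1 + z ^ 2)⁻¹) fun u => hC _ _ _ (by simp [Prod.norm_def]) (by simp [Prod.norm_def])
    have h₃ := norm_lineOsc_mul_abs_le F θ δ p q x y z (r := 1) (s := 0)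
      (K := C * (1 + z ^ 2)⁻¹) fun u => hC _ _ _ (by simp [Prod.norm_def]) (by simp [Prod.norm_def])
    rw [abs_one] at h₃
    simp only [pow_zero, mul_one]
    linarith
  | succ n ih =>
    obtain ⟨C₁, h₁, H₁⟩ := ih (∂_{((1, 0, 0, 0) : ℝ × ℝ × ℝ × ℝ)} F)
    obtain ⟨C₂, h₂, H₂⟩ := ih (∂_{((0, 1, 0, 0) : ℝ × ℝ × ℝ × ℝ)} F)
    obtain ⟨C₃, h₃, H₃⟩ := ih (∂_{((0, 0, 0, 1) : ℝ × ℝ × ℝ × ℝ)} F)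
    refine ⟨C₁ + C₂ + C₃, by positivity, fun θ δ p q x y z => ?_⟩
    have hv : ((p, q, 0, 1) : ℝ × ℝ × ℝ × ℝ) =
        p • (1, 0, 0, 0) + q • (0, 1, 0, 0) + (0, 0, 0, 1) := by simp
    have hparts := congrArg norm (lineOsc_mul_eq_neg_lineOsc_lineDeriv F θ δ p q x y z)
    rw [hv, LineDeriv.lineDerivOp_left_add, LineDeriv.lineDerivOp_left_add,
      LineDeriv.lineDerivOp_left_smul, LineDeriv.lineDerivOp_left_smul, lineOsc_add, lineOsc_add,
      lineOsc_smul, lineOsc_smul, norm_neg, norm_mul, norm_mul, Complex.norm_I, mul_one,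
      Complex.norm_real, Real.norm_eq_abs] at hparts
    specialize H₁ θ δ p q x y z
    specialize H₂ θ δ p q x y z
    specialize H₃ θ δ p q x y z
    set L₁ := lineOsc (∂_{((1, 0, 0, 0) : ℝ × ℝ × ℝ × ℝ)} F) θ δ p q x y z
    set L₂ := lineOsc (∂_{((0, 1, 0, 0) : ℝ × ℝ × ℝ × ℝ)} F) θ δ p q x y z
    set L₃ := lineOsc (∂_{((0, 0, 0, 1) : ℝ × ℝ × ℝ × ℝ)} F) θ δ p q x y z
    set X := |p| + |q| + 1 with hX
    have hp : |p| ≤ X := by linarith [abs_nonneg q]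
    have hq : |q| ≤ X := by linarith [abs_nonneg p]
    have h1 : 1 ≤ X := by linarith [abs_nonneg p, abs_nonneg q]
    have hX0 : 0 ≤ X := by linarith
    have hle : |θ| * ‖lineOsc F θ δ p q x y z‖ ≤ X * (‖L₁‖ + ‖L₂‖ + ‖L₃‖) := by
      rw [hparts]
      calc ‖(p : ℂ) * L₁ + q * L₂ + L₃‖ ≤ |p| * ‖L₁‖ + |q| * ‖L₂‖ + 1 * ‖L₃‖ := by
            refine (norm_add₃_le).trans_eq ?_
            simp
        _ ≤ X * ‖L₁‖ + X * ‖L₂‖ + X * ‖L₃‖ := by gcongr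
        _ = _ := by ring
    calc ‖lineOsc F θ δ p q x y z‖ * X * |θ| ^ (n + 1)
        = (|θ| * ‖lineOsc F θ δ p q x y z‖) * (X * |θ| ^ n) := by ring
      _ ≤ (X * (‖L₁‖ + ‖L₂‖ + ‖L₃‖)) * (X * |θ| ^ n) := by gcongr
      _ = X * (‖L₁‖ * X * |θ| ^ n + ‖L₂‖ * X * |θ| ^ n + ‖L₃‖ * X * |θ| ^ n) := by ring
      _ ≤ X * (C₁ * X ^ n * (1 + z ^ 2)⁻¹ + C₂ * X ^ n * (1 + z ^ 2)⁻¹ +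
            C₃ * X ^ n * (1 + z ^ 2)⁻¹) := by gcongr
      _ = _ := by ring

lemma Hosc_eq_integral_lineOsc (Φ : 𝓢(ℝ × ℝ × ℝ × ℝ, ℂ)) (M T a₁ a₂ b₁ b₂ : ℝ) :
    Hosc Φ M T a₁ a₂ b₁ b₂ = ∫ z : ℝ,
      lineOsc Φ (Real.pi * T * (a₁ * b₂ + a₂ * b₁))
        (2 * Real.pi * (z / (4 * M ^ 2) * ((a₁ + a₂) * (b₁ + b₂))))
        (T * (b₁ * b₂)) (T * (a₁ * a₂))
        (z / (4 * M ^ 2) * (b₁ + b₂) ^ 2) (z / (4 * M ^ 2) * (a₁ + a₂) ^ 2) z := by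
  unfold Hosc lineOsc
  refine integral_congr_ae (.of_forall fun z => integral_congr_ae (.of_forall fun u => ?_))
  dsimp only
  rw [mul_right_comm T u, mul_right_comm T u]
  congr 2
  push_cast
  ring

lemma exists_norm_Hosc_mul_pow_le (n : ℕ) (Φ : 𝓢(ℝ × ℝ × ℝ × ℝ, ℂ)) :
    ∃ C : ℝ, 0 ≤ C ∧ ∀ M T a₁ a₂ b₁ b₂ : ℝ, 0 ≤ T →
      ‖Hosc Φ M T a₁ a₂ b₁ b₂‖ * (T * (|a₁ * a₂| + |b₁ * b₂|) + 1) *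
        (T * |a₁ * b₂ + a₂ * b₁|) ^ n ≤ C * (T * (|a₁ * a₂| + |b₁ * b₂|) + 1) ^ n := by
  obtain ⟨C, hC₀, hC⟩ := exists_norm_lineOsc_le n Φ
  refine ⟨C * Real.pi, by positivity, fun M T a₁ a₂ b₁ b₂ hT => ?_⟩
  set X := T * (|a₁ * a₂| + |b₁ * b₂|) + 1 with hX
  set θ := Real.pi * T * (a₁ * b₂ + a₂ * b₁) with hθ
  have hpq : |T * (b₁ * b₂)| + |T * (a₁ * a₂)| + 1 = X := by
    rw [abs_mul T, abs_mul T, abs_of_nonneg hT]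
    ring
  have hX0 : 0 < X := by positivity
  have hθle : T * |a₁ * b₂ + a₂ * b₁| ≤ |θ| := by
    rw [hθ, abs_mul, abs_mul, abs_of_nonneg hT, abs_of_pos Real.pi_pos, mul_assoc]
    exact le_mul_of_one_le_left (by positivity) (by linarith [Real.pi_gt_three])
  set L : ℝ → ℂ := fun z => lineOsc Φ θ
    (2 * Real.pi * (z / (4 * M ^ 2) * ((a₁ + a₂) * (b₁ + b₂)))) (T * (b₁ * b₂)) (T * (a₁ * a₂))
    (z / (4 * M ^ 2) * (b₁ + b₂) ^ 2) (z / (4 * M ^ 2) * (a₁ + a₂) ^ 2) z with hL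
  have hbound (z : ℝ) : ‖(X * |θ| ^ n) • L z‖ ≤ C * X ^ n * (1 + z ^ 2)⁻¹ := by
    have := hC θ (2 * Real.pi * (z / (4 * M ^ 2) * ((a₁ + a₂) * (b₁ + b₂))))
      (T * (b₁ * b₂)) (T * (a₁ * a₂))
      (z / (4 * M ^ 2) * (b₁ + b₂) ^ 2) (z / (4 * M ^ 2) * (a₁ + a₂) ^ 2) z
    rw [hpq] at this
    rw [norm_smul, Real.norm_of_nonneg (by positivity), mul_comm, ← mul_assoc]
    exact this
  have hnorm := norm_integral_le_of_norm_le
    (integrable_inv_one_add_sq.const_mul (C * X ^ n)) (.of_forall hbound)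
  rw [integral_smul, norm_smul, Real.norm_of_nonneg (by positivity), integral_const_mul,
    integral_univ_inv_one_add_sq, ← Hosc_eq_integral_lineOsc] at hnorm
  calc ‖Hosc Φ M T a₁ a₂ b₁ b₂‖ * X * (T * |a₁ * b₂ + a₂ * b₁|) ^ n
      ≤ ‖Hosc Φ M T a₁ a₂ b₁ b₂‖ * X * |θ| ^ n := by gcongr
    _ = X * |θ| ^ n * ‖Hosc Φ M T a₁ a₂ b₁ b₂‖ := by ring
    _ ≤ C * X ^ n * Real.pi := hnorm
    _ = C * Real.pi * X ^ n := by ring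

lemma exists_norm_Hosc_mul_one_add_pow_le (n : ℕ) (Φ : 𝓢(ℝ × ℝ × ℝ × ℝ, ℂ)) :
    ∃ C : ℝ, 0 < C ∧ ∀ M T a₁ a₂ b₁ b₂ : ℝ, 0 < T →
      ‖Hosc Φ M T a₁ a₂ b₁ b₂‖ * (T * (|a₁ * a₂| + |b₁ * b₂|) + 1) *
        (1 + |a₁ * b₂ + a₂ * b₁| / (|a₁ * a₂| + |b₁ * b₂| + 1 / T)) ^ n ≤ C := by
  obtain ⟨C₀, h₀, H₀⟩ := exists_norm_Hosc_mul_pow_le 0 Φ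
  obtain ⟨C₁, h₁, H₁⟩ := exists_norm_Hosc_mul_pow_le n Φ
  refine ⟨2 ^ (n - 1) * (C₀ + C₁) + 1, by positivity, fun M T a₁ a₂ b₁ b₂ hT => ?_⟩
  specialize H₀ M T a₁ a₂ b₁ b₂ hT.le
  specialize H₁ M T a₁ a₂ b₁ b₂ hT.le
  set X := T * (|a₁ * a₂| + |b₁ * b₂|) + 1 with hX
  have hX0 : 0 < X := by positivity
  have hρ : |a₁ * b₂ + a₂ * b₁| / (|a₁ * a₂| + |b₁ * b₂| + 1 / T) =
      T * |a₁ * b₂ + a₂ * b₁| / X := by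
    rw [hX]
    field_simp
  rw [hρ]
  set ρ := T * |a₁ * b₂ + a₂ * b₁| / X with hρX
  have hρ0 : 0 ≤ ρ := by positivity
  have H₁' : ‖Hosc Φ M T a₁ a₂ b₁ b₂‖ * X * ρ ^ n ≤ C₁ := by
    rw [hρX, div_pow, ← mul_div_assoc, div_le_iff₀ (by positivity)]
    exact H₁
  simp only [pow_zero, mul_one] at H₀
  calc ‖Hosc Φ M T a₁ a₂ b₁ b₂‖ * X * (1 + ρ) ^ n
      ≤ ‖Hosc Φ M T a₁ a₂ b₁ b₂‖ * X * (2 ^ (n - 1) * (1 ^ n + ρ ^ n)) := by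
        gcongr
        exact add_pow_le zero_le_one hρ0 n
    _ = 2 ^ (n - 1) *
          (‖Hosc Φ M T a₁ a₂ b₁ b₂‖ * X + ‖Hosc Φ M T a₁ a₂ b₁ b₂‖ * X * ρ ^ n) := by
        rw [one_pow]
        ring
    _ ≤ 2 ^ (n - 1) * (C₀ + C₁) := by gcongr
    _ ≤ _ := by linarith

/-- **Bound (2.6)/(2.7).** For every `A > 0`,
`|ℋ(a,b)| ≪_{A,Φ} (T(|a₁a₂|+|b₁b₂|)+1)⁻¹ (1 + |a₁b₂+a₂b₁|/(|a₁a₂|+|b₁b₂|+1/T))^{-A}`,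
and in particular `|ℋ(a,b)| ≪_Φ 1/(T·max(|a₁a₂|,|b₁b₂|,|a₁b₂+a₂b₁|) + 1)`. -/
theorem Hosc_bound (Φ : 𝓢(ℝ × ℝ × ℝ × ℝ, ℂ)) (A : ℝ) (hA : 0 < A) :
    ∃ C : ℝ, 0 < C ∧ ∀ M T a₁ a₂ b₁ b₂ : ℝ, 1 ≤ M → 1 ≤ T →
      ‖Hosc Φ M T a₁ a₂ b₁ b₂‖ ≤
          C * (T * (|a₁ * a₂| + |b₁ * b₂|) + 1)⁻¹ *
            (1 + |a₁ * b₂ + a₂ * b₁| / (|a₁ * a₂| + |b₁ * b₂| + 1 / T)) ^ (-A) ∧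
      ‖Hosc Φ M T a₁ a₂ b₁ b₂‖ ≤
          C / (T * max (max |a₁ * a₂| |b₁ * b₂|) |a₁ * b₂ + a₂ * b₁| + 1) := by
  obtain ⟨C, hC₀, hC⟩ := exists_norm_Hosc_mul_one_add_pow_le (⌈A⌉₊ + 1) Φ
  refine ⟨C, hC₀, fun M T a₁ a₂ b₁ b₂ _ hT => ?_⟩
  have hT0 : 0 < T := by linarith
  specialize hC M T a₁ a₂ b₁ b₂ hT0
  set S := |a₁ * a₂| + |b₁ * b₂| with hS
  have hS0 : 0 ≤ S := by positivity
  set ρ := |a₁ * b₂ + a₂ * b₁| / (S + 1 / T) with hρ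
  have hρ0 : 0 ≤ ρ := by positivity
  constructor
  · rw [Real.rpow_neg (by positivity), mul_assoc, ← mul_inv, ← div_eq_mul_inv,
      le_div_iff₀ (by positivity), ← mul_assoc]
    refine le_trans ?_ hC
    gcongr
    rw [← Real.rpow_natCast]
    refine Real.rpow_le_rpow_of_exponent_le (by linarith) ?_
    push_cast
    linarith [Nat.le_ceil A]
  · have hmax : T * max (max |a₁ * a₂| |b₁ * b₂|) |a₁ * b₂ + a₂ * b₁| + 1 ≤
        (T * S + 1) * (1 + ρ) := by
      have hexp : (T * S + 1) * (1 + ρ) = T * (S + |a₁ * b₂ + a₂ * b₁|) + 1 := by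
        rw [hρ]
        field_simp
        ring
      rw [hexp]
      gcongr
      refine max_le (max_le ?_ ?_) ?_ <;>
        linarith [abs_nonneg (a₁ * a₂), abs_nonneg (b₁ * b₂), abs_nonneg (a₁ * b₂ + a₂ * b₁)]
    rw [le_div_iff₀ (by positivity)]
    calc _ ≤ ‖Hosc Φ M T a₁ a₂ b₁ b₂‖ * ((T * S + 1) * (1 + ρ)) := by gcongr
      _ = ‖Hosc Φ M T a₁ a₂ b₁ b₂‖ * (T * S + 1) * (1 + ρ) := by ring
      _ ≤ ‖Hosc Φ M T a₁ a₂ b₁ b₂‖ * (T * S + 1) * (1 + ρ) ^ (⌈A⌉₊ + 1) := by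
        gcongr
        exact le_self_pow₀ (by linarith) (Nat.succ_ne_zero _)
      _ ≤ C := hC
end

section
/- Fix η > 0, 0 < δ < 1/2 and ε > 0, and suppose M^η ≤ T ≤ M^{2−η}. Then the sum of 1/(T²(|Δ| + P/T)) over all integer 8-tuples (a,b) = (a₁,…,a₄,b₁,…,b₄) satisfying: (a₁,b₁) ≠ (0,0) ≠ (a₂,b₂), (a₃,b₃) ≠ (0,0) ≠ (a₄,b₄), |aᵢ|, |bᵢ| ≤ M for all i, P ≠ 0, |Δ| ≤ M^{4−δ}, and |Δ₁|, |Δ₂| ≤ M^ε(|Δ| + P/T), is ≪_{η,δ,ε} M^ε·(M^{4−δ/5}/T² + M²/T). -/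
open scoped Classical

noncomputable section

/-- `P = max(|a₁a₂|, |a₃a₄|, |b₁b₂|, |b₃b₄|)` for an integer 8-tuple `x = (a, b)`. -/
def Pmax (x : (Fin 4 → ℤ) × (Fin 4 → ℤ)) : ℤ :=
  max (max |x.1 0 * x.1 1| |x.1 2 * x.1 3|) (max |x.2 0 * x.2 1| |x.2 2 * x.2 3|)

/-- `Δ = a₁a₂a₃a₄ - b₁b₂b₃b₄`. -/
def Δ₀ (x : (Fin 4 → ℤ) × (Fin 4 → ℤ)) : ℤ :=
  x.1 0 * x.1 1 * x.1 2 * x.1 3 - x.2 0 * x.2 1 * x.2 2 * x.2 3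

/-- `Δ₁ = a₁a₂b₃a₄ + a₁a₂a₃b₄ - a₁b₂b₃b₄ - b₁a₂b₃b₄`. -/
def Δ₁ (x : (Fin 4 → ℤ) × (Fin 4 → ℤ)) : ℤ :=
  x.1 0 * x.1 1 * x.2 2 * x.1 3 + x.1 0 * x.1 1 * x.1 2 * x.2 3 -
    x.1 0 * x.2 1 * x.2 2 * x.2 3 - x.2 0 * x.1 1 * x.2 2 * x.2 3

/-- `Δ₂ = a₁b₂a₃a₄ + b₁a₂a₃a₄ - b₁b₂a₃b₄ - b₁b₂b₃a₄`. -/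
def Δ₂ (x : (Fin 4 → ℤ) × (Fin 4 → ℤ)) : ℤ :=
  x.1 0 * x.2 1 * x.1 2 * x.1 3 + x.2 0 * x.1 1 * x.1 2 * x.1 3 -
    x.2 0 * x.2 1 * x.1 2 * x.2 3 - x.2 0 * x.2 1 * x.2 2 * x.1 3

end

theorem card_divisors_le_rpow (ν : ℝ) (hν : 0 < ν) :
    ∃ C : ℝ, 1 ≤ C ∧ ∀ n : ℕ, n ≠ 0 → (n.divisors.card : ℝ) ≤ C * (n : ℝ) ^ ν := by
  set c : ℝ := 1 + 1 / (ν * Real.log 2) with hc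
  have hl : 0 < Real.log 2 := Real.log_pos (by norm_num)
  have hc1 : 1 ≤ c := by
    have : 0 < 1 / (ν * Real.log 2) := by positivity
    linarith
  obtain ⟨Q, hQ⟩ := exists_nat_ge ((2 : ℝ) ^ (1 / ν))
  refine ⟨c ^ Q, one_le_pow₀ hc1, fun n hn => ?_⟩
  have key : ∀ p ∈ n.primeFactors, ((n.factorization p : ℝ) + 1) ≤
      (if p < Q then c else 1) * ((p : ℝ) ^ ν) ^ n.factorization p := by
    intro p hp
    have hp2 : (2 : ℝ) ≤ p := by exact_mod_cast (Nat.prime_of_mem_primeFactors hp).two_le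
    set k := n.factorization p
    split_ifs with h
    · have h1 : 1 + (k : ℝ) * (ν * Real.log 2) ≤ ((p : ℝ) ^ ν) ^ k := by
        have h2 : 1 + (ν * Real.log 2) ≤ (p : ℝ) ^ ν := by
          calc 1 + ν * Real.log 2 ≤ Real.exp (Real.log 2 * ν) := by
                have := Real.add_one_le_exp (Real.log 2 * ν); linarith
            _ = (2 : ℝ) ^ ν := (Real.rpow_def_of_pos (by norm_num) ν).symm
            _ ≤ (p : ℝ) ^ ν := Real.rpow_le_rpow (by norm_num) hp2 hν.le
        calc _ ≤ (1 + ν * Real.log 2) ^ k :=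
              one_add_mul_le_pow (by nlinarith [mul_pos hν hl]) k
          _ ≤ _ := pow_le_pow_left₀ (by positivity) h2 k
      calc (k : ℝ) + 1 ≤ c * (1 + (k : ℝ) * (ν * Real.log 2)) := by
            have hx : 0 < ν * Real.log 2 := by positivity
            have : c * (1 + (k : ℝ) * (ν * Real.log 2)) =
                1 + (k : ℝ) + (k : ℝ) * (ν * Real.log 2) + 1 / (ν * Real.log 2) := by
              rw [hc]; field_simp; ring
            rw [this]
            have : 0 ≤ (k : ℝ) * (ν * Real.log 2) := by positivity
            have : 0 ≤ 1 / (ν * Real.log 2) := by positivity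
            linarith
        _ ≤ _ := by gcongr
    · have h2 : (2 : ℝ) ≤ (p : ℝ) ^ ν := by
        have : (2 : ℝ) ^ (1 / ν) ≤ p := hQ.trans (by exact_mod_cast not_lt.mp h)
        calc (2 : ℝ) = ((2 : ℝ) ^ (1 / ν)) ^ ν := by
              rw [← Real.rpow_mul (by norm_num), one_div, inv_mul_cancel₀ hν.ne', Real.rpow_one]
          _ ≤ _ := Real.rpow_le_rpow (by positivity) this hν.le
      rw [one_mul]
      calc (k : ℝ) + 1 ≤ 2 ^ k := by exact_mod_cast Nat.lt_two_pow_self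
        _ ≤ _ := pow_le_pow_left₀ (by norm_num) h2 k
  have hprod : ∏ p ∈ n.primeFactors, (if p < Q then c else 1) ≤ c ^ Q := by
    rw [Finset.prod_ite, Finset.prod_const_one, mul_one, Finset.prod_const]
    refine pow_le_pow_right₀ hc1 ?_
    calc _ ≤ (Finset.range Q).card := Finset.card_le_card (by
            intro p hp; simpa using (Finset.mem_filter.mp hp).2)
      _ = Q := Finset.card_range Q
  have hn' : (n : ℝ) ^ ν = ∏ p ∈ n.primeFactors, ((p : ℝ) ^ ν) ^ n.factorization p := by
    conv_lhs => rw [← Nat.prod_factorization_pow_eq_self hn]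
    rw [Finsupp.prod, Nat.support_factorization, Nat.cast_prod,
      ← Real.finsetProd_rpow _ _ (fun i _ => by positivity)]
    refine Finset.prod_congr rfl fun p _ => ?_
    rw [Nat.cast_pow, ← Real.rpow_natCast, ← Real.rpow_natCast, ← Real.rpow_mul (by positivity),
      ← Real.rpow_mul (by positivity), mul_comm]
  calc (n.divisors.card : ℝ) = ∏ p ∈ n.primeFactors, ((n.factorization p : ℝ) + 1) := by
        rw [Nat.card_divisors hn]; push_cast; rfl
    _ ≤ ∏ p ∈ n.primeFactors, ((if p < Q then c else 1) * ((p : ℝ) ^ ν) ^ n.factorization p) :=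
        Finset.prod_le_prod (fun _ _ => by positivity) key
    _ = (∏ p ∈ n.primeFactors, (if p < Q then c else 1)) * (n : ℝ) ^ ν := by
        rw [Finset.prod_mul_distrib, hn']
    _ ≤ c ^ Q * (n : ℝ) ^ ν := by gcongr

/-- The integers of absolute value at most `r`. -/
noncomputable def intBall (r : ℝ) : Finset ℤ := Finset.Icc (-⌊r⌋) ⌊r⌋

theorem mem_intBall {r : ℝ} {n : ℤ} : n ∈ intBall r ↔ |(n : ℝ)| ≤ r := by
  rw [intBall, Finset.mem_Icc, ← abs_le, Int.le_floor, Int.cast_abs]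

theorem card_intBall_le {r : ℝ} (hr : 1 ≤ r) : ((intBall r).card : ℝ) ≤ 3 * r := by
  have h0 : 0 ≤ ⌊r⌋ := Int.floor_nonneg.mpr (by linarith)
  have : ((intBall r).card : ℤ) = ⌊r⌋ + 1 - (-⌊r⌋) := by
    rw [intBall, Int.card_Icc, Int.toNat_of_nonneg (by linarith)]
  have h2 : ((intBall r).card : ℝ) = ⌊r⌋ + 1 - (-⌊r⌋) := by exact_mod_cast this
  rw [h2]
  linarith [Int.floor_le r]

theorem intBall_mono {r s : ℝ} (h : r ≤ s) : intBall r ⊆ intBall s := fun _ hn =>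
  mem_intBall.mpr ((mem_intBall.mp hn).trans h)

theorem sum_inv_intBall_le (N : ℕ) :
    ∑ n ∈ intBall N, |(n : ℝ)|⁻¹ ≤ 2 * (1 + Real.log N) := by
  have hsub : intBall N ⊆ insert 0 ((Finset.Icc 1 N).image (fun k : ℕ => (k : ℤ)) ∪
      (Finset.Icc 1 N).image (fun k : ℕ => -(k : ℤ))) := by
    intro n hn
    rw [intBall, Int.floor_natCast, Finset.mem_Icc] at hn
    simp only [Finset.mem_insert, Finset.mem_union, Finset.mem_image, Finset.mem_Icc]
    rcases lt_trichotomy n 0 with h | h | h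
    · exact Or.inr (Or.inr ⟨n.natAbs, by omega, by omega⟩)
    · exact Or.inl h
    · exact Or.inr (Or.inl ⟨n.natAbs, by omega, by omega⟩)
  have hH : ∑ k ∈ Finset.Icc 1 N, (k : ℝ)⁻¹ ≤ 1 + Real.log N := by
    have := harmonic_le_one_add_log N
    rw [harmonic_eq_sum_Icc] at this
    push_cast at this
    exact this
  calc _ ≤ ∑ n ∈ insert 0 ((Finset.Icc 1 N).image (fun k : ℕ => (k : ℤ)) ∪
      (Finset.Icc 1 N).image (fun k : ℕ => -(k : ℤ))), |(n : ℝ)|⁻¹ :=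
        Finset.sum_le_sum_of_subset_of_nonneg hsub fun _ _ _ => by positivity
    _ ≤ ∑ n ∈ (Finset.Icc 1 N).image (fun k : ℕ => (k : ℤ)), |(n : ℝ)|⁻¹ +
        ∑ n ∈ (Finset.Icc 1 N).image (fun k : ℕ => -(k : ℤ)), |(n : ℝ)|⁻¹ := by
        rw [Finset.sum_insert_zero (by simp), ← Finset.sum_union_inter]
        exact le_add_of_nonneg_right (Finset.sum_nonneg fun _ _ => by positivity)
    _ ≤ 2 * (1 + Real.log N) := by
        rw [Finset.sum_image (by intro a _ b _ h; simpa using h),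
          Finset.sum_image (by intro a _ b _ h; simpa using h)]
        simp only [Int.cast_neg, abs_neg, Int.cast_natCast, Nat.abs_cast]
        linarith

/-- The positive and negative divisors of a nonzero integer. -/
def intDivs (n : ℤ) : Finset ℤ :=
  n.natAbs.divisors.image (fun k : ℕ => (k : ℤ)) ∪ n.natAbs.divisors.image (fun k : ℕ => -(k : ℤ))

theorem mem_intDivs {n d : ℤ} (hn : n ≠ 0) (h : d ∣ n) : d ∈ intDivs n := by
  have hd : d.natAbs ∈ n.natAbs.divisors :=
    Nat.mem_divisors.mpr ⟨Int.natAbs_dvd_natAbs.mpr h, Int.natAbs_ne_zero.mpr hn⟩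
  simp only [intDivs, Finset.mem_union, Finset.mem_image]
  rcases le_total 0 d with h0 | h0
  · exact Or.inl ⟨_, hd, by omega⟩
  · exact Or.inr ⟨_, hd, by omega⟩

theorem card_intDivs_le (n : ℤ) : (intDivs n).card ≤ 2 * n.natAbs.divisors.card := by
  rw [two_mul]
  exact (Finset.card_union_le _ _).trans (add_le_add Finset.card_image_le Finset.card_image_le)

/-- `Λ` bounds both the number of divisors of nonzero integers up to `R` and the harmonic sum
over integers up to `R`. -/
structure DivisorHarmonicBound (R Λ : ℝ) : Prop where
  one_le : 1 ≤ Λ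
  divs : ∀ n : ℤ, n ≠ 0 → |(n : ℝ)| ≤ R → ((intDivs n).card : ℝ) ≤ Λ
  harm : ∑ n ∈ intBall R, |(n : ℝ)|⁻¹ ≤ Λ

theorem exists_divisorHarmonicBound (ν : ℝ) (hν : 0 < ν) :
    ∃ C : ℝ, 1 ≤ C ∧ ∀ R : ℝ, 1 ≤ R → DivisorHarmonicBound R (C * R ^ ν) := by
  obtain ⟨C, hC, h⟩ := card_divisors_le_rpow ν hν
  have hp : 0 ≤ 2 ^ ν / ν := by positivity
  refine ⟨2 * C + 2 * (1 + 2 ^ ν / ν), by linarith, fun R hR => ?_⟩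
  have hRν : 1 ≤ R ^ ν := Real.one_le_rpow hR hν.le
  refine ⟨?_, fun n hn hnR => ?_, ?_⟩
  · nlinarith
  · have h1 : ((intDivs n).card : ℝ) ≤ 2 * n.natAbs.divisors.card := by
      exact_mod_cast card_intDivs_le n
    have h2 := h n.natAbs (Int.natAbs_ne_zero.mpr hn)
    have h3 : ((n.natAbs : ℕ) : ℝ) = |(n : ℝ)| := by
      rw [Nat.cast_natAbs, Int.cast_abs]
    rw [h3] at h2
    have h4 : |(n : ℝ)| ^ ν ≤ R ^ ν := Real.rpow_le_rpow (abs_nonneg _) hnR hν.le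
    have h5 : C * |(n : ℝ)| ^ ν ≤ C * R ^ ν := by gcongr
    nlinarith
  · have hN : R ≤ (⌈R⌉₊ : ℝ) := Nat.le_ceil R
    have hN2 : (⌈R⌉₊ : ℝ) ≤ 2 * R := by
      have := Nat.ceil_lt_add_one (show 0 ≤ R by linarith); linarith
    calc _ ≤ ∑ n ∈ intBall (⌈R⌉₊ : ℝ), |(n : ℝ)|⁻¹ :=
          Finset.sum_le_sum_of_subset_of_nonneg (intBall_mono hN) fun _ _ _ => by positivity
      _ ≤ 2 * (1 + Real.log ⌈R⌉₊) := sum_inv_intBall_le _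
      _ ≤ 2 * (1 + Real.log (2 * R)) := by
          have := Real.log_le_log (by linarith) hN2
          linarith
      _ ≤ 2 * (1 + (2 * R) ^ ν / ν) := by
          have := Real.log_le_rpow_div (show 0 ≤ 2 * R by linarith) hν
          linarith
      _ = 2 * (1 + 2 ^ ν / ν * R ^ ν) := by
          rw [Real.mul_rpow (by norm_num) (by linarith)]; ring
      _ ≤ _ := by nlinarith

theorem card_le_mul_of_dvd {α : Type*} {R Λ : ℝ} (hΛ : DivisorHarmonicBound R Λ) (S : Finset α)
    (f : α → ℤ) {n : ℤ} (hn : n ≠ 0) (hR : |(n : ℝ)| ≤ R) (hf : ∀ x ∈ S, f x ∣ n) {F : ℝ}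
    (hF0 : 0 ≤ F)
    (hF : ∀ c, c ∣ n → ((S.filter (fun x => f x = c)).card : ℝ) ≤ F) : (S.card : ℝ) ≤ Λ * F := by
  have hmap : ∀ x ∈ S, f x ∈ (intDivs n).filter (· ∣ n) := fun x hx =>
    Finset.mem_filter.mpr ⟨mem_intDivs hn (hf x hx), hf x hx⟩
  calc (S.card : ℝ)
      = ∑ c ∈ (intDivs n).filter (· ∣ n), ((S.filter (fun x => f x = c)).card : ℝ) := by
        exact_mod_cast Finset.card_eq_sum_card_fiberwise hmap
    _ ≤ ∑ c ∈ (intDivs n).filter (· ∣ n), F :=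
        Finset.sum_le_sum fun c hc => hF c (Finset.mem_filter.mp hc).2
    _ = ((intDivs n).filter (· ∣ n)).card * F := by rw [Finset.sum_const, nsmul_eq_mul]
    _ ≤ (intDivs n).card * F := by
        gcongr; exact Finset.filter_subset _ _
    _ ≤ Λ * F := by gcongr; exact hΛ.divs n hn hR

theorem card_le_pow_of_dvd {α : Type*} {R Λ : ℝ} (hΛ : DivisorHarmonicBound R Λ) {k : ℕ}
    (S : Finset α) (f : α → Fin k → ℤ) (n : Fin k → ℤ) (hn : ∀ i, n i ≠ 0)
    (hR : ∀ i, |(n i : ℝ)| ≤ R) (hf : ∀ x ∈ S, ∀ i, f x i ∣ n i)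
    (hinj : ∀ x ∈ S, ∀ y ∈ S, f x = f y → x = y) : (S.card : ℝ) ≤ Λ ^ k := by
  have h1 : S.card ≤ (Fintype.piFinset fun i => intDivs (n i)).card :=
    Finset.card_le_card_of_injOn f
      (fun x hx => Fintype.mem_piFinset.mpr fun i => mem_intDivs (hn i) (hf x hx i))
      (fun x hx y hy h => hinj x hx y hy h)
  rw [Fintype.card_piFinset] at h1
  calc (S.card : ℝ) ≤ ∏ i, ((intDivs (n i)).card : ℝ) := by exact_mod_cast h1
    _ ≤ ∏ _i : Fin k, Λ :=
        Finset.prod_le_prod (fun _ _ => by positivity) fun i _ => hΛ.divs _ (hn i) (hR i)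
    _ = Λ ^ k := by simp

theorem sum_le_of_fibers {α : Type*} {R Λ : ℝ} (hΛ : DivisorHarmonicBound R Λ) {p q : ℕ}
    (S : Finset α) (w : α → ℝ) (φ : α → Fin p → ℤ) (ψ : α → Fin q → ℤ) (r : Fin q → ℝ)
    {K F : ℝ} (hK : 0 ≤ K) (hr : ∀ j, 1 ≤ r j)
    (hφ : ∀ x ∈ S, ∀ i, |(φ x i : ℝ)| ≤ R) (hψ : ∀ x ∈ S, ∀ j, |(ψ x j : ℝ)| ≤ r j)
    (hw : ∀ x ∈ S, w x ≤ K * ∏ i, |(φ x i : ℝ)|⁻¹) (hF : 0 ≤ F)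
    (hfib : ∀ x₀ ∈ S, ∀ S' ⊆ S, (∀ x ∈ S', φ x = φ x₀ ∧ ψ x = ψ x₀) → (S'.card : ℝ) ≤ F) :
    ∑ x ∈ S, w x ≤ K * F * Λ ^ p * ∏ j, (3 * r j) := by
  set A := Fintype.piFinset fun _ : Fin p => intBall R
  set B := Fintype.piFinset fun j : Fin q => intBall (r j)
  have hmap : ∀ x ∈ S, (φ x, ψ x) ∈ A ×ˢ B := fun x hx => Finset.mem_product.mpr
    ⟨Fintype.mem_piFinset.mpr fun i => mem_intBall.mpr (hφ x hx i),
      Fintype.mem_piFinset.mpr fun j => mem_intBall.mpr (hψ x hx j)⟩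
  have hP : ∀ z : Fin p → ℤ, 0 ≤ ∏ i, |(z i : ℝ)|⁻¹ := fun z =>
    Finset.prod_nonneg fun _ _ => by positivity
  have hΛ0 : 0 ≤ Λ := zero_le_one.trans hΛ.one_le
  calc ∑ x ∈ S, w x = ∑ z ∈ A ×ˢ B, ∑ x ∈ S.filter (fun x => (φ x, ψ x) = z), w x :=
        (Finset.sum_fiberwise_of_maps_to hmap w).symm
    _ ≤ ∑ z ∈ A ×ˢ B, K * F * ∏ i, |(z.1 i : ℝ)|⁻¹ := by
        refine Finset.sum_le_sum fun z _ => ?_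
        have hcard : ((S.filter (fun x => (φ x, ψ x) = z)).card : ℝ) ≤ F := by
          rcases (S.filter (fun x => (φ x, ψ x) = z)).eq_empty_or_nonempty with h | ⟨x₀, h₀⟩
          · rw [h]; simpa using hF
          · refine hfib x₀ (Finset.mem_filter.mp h₀).1 _ (Finset.filter_subset _ _) fun x hx => ?_
            have := (Finset.mem_filter.mp hx).2.trans (Finset.mem_filter.mp h₀).2.symm
            exact Prod.mk.inj this
        calc _ ≤ ∑ x ∈ S.filter (fun x => (φ x, ψ x) = z), K * ∏ i, |(z.1 i : ℝ)|⁻¹ := by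
              refine Finset.sum_le_sum fun x hx => ?_
              obtain ⟨hxS, rfl⟩ := Finset.mem_filter.mp hx
              exact hw x hxS
          _ = (S.filter (fun x => (φ x, ψ x) = z)).card * (K * ∏ i, |(z.1 i : ℝ)|⁻¹) := by
              rw [Finset.sum_const, nsmul_eq_mul]
          _ ≤ F * (K * ∏ i, |(z.1 i : ℝ)|⁻¹) :=
              mul_le_mul_of_nonneg_right hcard (mul_nonneg hK (hP _))
          _ = _ := by ring
    _ = K * F * (∑ a ∈ A, ∏ i, |(a i : ℝ)|⁻¹) * B.card := by
        rw [Finset.sum_product, Finset.mul_sum, Finset.sum_mul]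
        refine Finset.sum_congr rfl fun a _ => ?_
        simp only [Finset.sum_const, nsmul_eq_mul]
        ring
    _ = K * F * (∑ n ∈ intBall R, |(n : ℝ)|⁻¹) ^ p * ∏ j, ((intBall (r j)).card : ℝ) := by
        rw [← Finset.prod_univ_sum (fun _ => intBall R) (fun _ n => |(n : ℝ)|⁻¹),
          Fintype.card_piFinset]
        simp
    _ ≤ K * F * Λ ^ p * ∏ j, (3 * r j) := by
        have h1 : 0 ≤ ∑ n ∈ intBall R, |(n : ℝ)|⁻¹ :=
          Finset.sum_nonneg fun _ _ => by positivity
        have h2 : ∏ j, ((intBall (r j)).card : ℝ) ≤ ∏ j, (3 * r j) :=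
          Finset.prod_le_prod (fun _ _ => by positivity) fun j _ => card_intBall_le (hr j)
        have h3 := pow_le_pow_left₀ h1 hΛ.harm p
        have h4 : 0 ≤ ∏ j, ((intBall (r j)).card : ℝ) :=
          Finset.prod_nonneg fun _ _ => by positivity
        have h5 : 0 ≤ K * F * Λ ^ p := by positivity
        exact mul_le_mul (mul_le_mul_of_nonneg_left h3 (mul_nonneg hK hF)) h2 h4 h5

theorem abs_mul_le_mul {a b r s : ℝ} (ha : |a| ≤ r) (hb : |b| ≤ s) : |a * b| ≤ r * s := by
  rw [abs_mul]
  exact mul_le_mul ha hb (abs_nonneg _) ((abs_nonneg _).trans ha)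

/-- The conditions under which an 8-tuple contributes to the sum. -/
structure Admissible (M T ε δ : ℝ) (x : (Fin 4 → ℤ) × (Fin 4 → ℤ)) : Prop where
  ne : ∀ i, x.1 i ≠ 0 ∨ x.2 i ≠ 0
  fst_le : ∀ i, |(x.1 i : ℝ)| ≤ M
  snd_le : ∀ i, |(x.2 i : ℝ)| ≤ M
  pos : 0 < Pmax x
  le₀ : |(Δ₀ x : ℝ)| ≤ M ^ (4 - δ)
  le₁ : |(Δ₁ x : ℝ)| ≤ M ^ ε * (|(Δ₀ x : ℝ)| + (Pmax x : ℝ) / T)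
  le₂ : |(Δ₂ x : ℝ)| ≤ M ^ ε * (|(Δ₀ x : ℝ)| + (Pmax x : ℝ) / T)

/-- The summand attached to an 8-tuple. -/
noncomputable def weight (T : ℝ) (x : (Fin 4 → ℤ) × (Fin 4 → ℤ)) : ℝ :=
  (T ^ 2 * (|(Δ₀ x : ℝ)| + (Pmax x : ℝ) / T))⁻¹

/-- The weights of any finite set of admissible tuples satisfying `p` add up to at most `c`. -/
def WeightBound (M T ε δ : ℝ) (p : (Fin 4 → ℤ) × (Fin 4 → ℤ) → Prop) (c : ℝ) : Prop :=
  ∀ S : Finset ((Fin 4 → ℤ) × (Fin 4 → ℤ)), (∀ x ∈ S, Admissible M T ε δ x ∧ p x) →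
    ∑ x ∈ S, weight T x ≤ c

/-- Exchange the first two pairs. -/
def swapLeft (x : (Fin 4 → ℤ) × (Fin 4 → ℤ)) : (Fin 4 → ℤ) × (Fin 4 → ℤ) :=
  (![x.1 1, x.1 0, x.1 2, x.1 3], ![x.2 1, x.2 0, x.2 2, x.2 3])

/-- Exchange the last two pairs. -/
def swapRight (x : (Fin 4 → ℤ) × (Fin 4 → ℤ)) : (Fin 4 → ℤ) × (Fin 4 → ℤ) :=
  (![x.1 0, x.1 1, x.1 3, x.1 2], ![x.2 0, x.2 1, x.2 3, x.2 2])

/-- Exchange the first two pairs with the last two. -/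
def swapHalves (x : (Fin 4 → ℤ) × (Fin 4 → ℤ)) : (Fin 4 → ℤ) × (Fin 4 → ℤ) :=
  (![x.1 2, x.1 3, x.1 0, x.1 1], ![x.2 2, x.2 3, x.2 0, x.2 1])

theorem tuple_ext {x y : (Fin 4 → ℤ) × (Fin 4 → ℤ)} (a₀ : x.1 0 = y.1 0) (a₁ : x.1 1 = y.1 1)
    (a₂ : x.1 2 = y.1 2) (a₃ : x.1 3 = y.1 3) (b₀ : x.2 0 = y.2 0) (b₁ : x.2 1 = y.2 1)
    (b₂ : x.2 2 = y.2 2) (b₃ : x.2 3 = y.2 3) : x = y := by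
  refine Prod.ext (funext fun i => ?_) (funext fun i => ?_) <;> fin_cases i <;> assumption

theorem swapLeft_involutive : Function.Involutive swapLeft := fun _ =>
  tuple_ext rfl rfl rfl rfl rfl rfl rfl rfl

theorem swapRight_involutive : Function.Involutive swapRight := fun _ =>
  tuple_ext rfl rfl rfl rfl rfl rfl rfl rfl

theorem swapHalves_involutive : Function.Involutive swapHalves := fun _ =>
  tuple_ext rfl rfl rfl rfl rfl rfl rfl rfl

namespace Admissible

variable {M T ε δ : ℝ} {x : (Fin 4 → ℤ) × (Fin 4 → ℤ)}

theorem of_invariant {y : (Fin 4 → ℤ) × (Fin 4 → ℤ)} (h : Admissible M T ε δ x)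
    (hne : ∀ i, y.1 i ≠ 0 ∨ y.2 i ≠ 0)
    (hf : ∀ i, |(y.1 i : ℝ)| ≤ M) (hs : ∀ i, |(y.2 i : ℝ)| ≤ M) (hP : Pmax y = Pmax x)
    (h₀ : |Δ₀ y| = |Δ₀ x|)
    (h₁ : |Δ₁ y| = |Δ₁ x| ∧ |Δ₂ y| = |Δ₂ x| ∨ |Δ₁ y| = |Δ₂ x| ∧ |Δ₂ y| = |Δ₁ x|) :
    Admissible M T ε δ y ∧ weight T y = weight T x := by
  have e₀ : |(Δ₀ y : ℝ)| = |(Δ₀ x : ℝ)| := by exact_mod_cast h₀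
  refine ⟨⟨hne, hf, hs, hP ▸ h.pos, e₀ ▸ h.le₀, ?_, ?_⟩, ?_⟩
  · rw [e₀, hP]
    rcases h₁ with ⟨h, -⟩ | ⟨h, -⟩ <;> rw [← Int.cast_abs, h, Int.cast_abs]
    exacts [Admissible.le₁ ‹_›, Admissible.le₂ ‹_›]
  · rw [e₀, hP]
    rcases h₁ with ⟨-, h⟩ | ⟨-, h⟩ <;> rw [← Int.cast_abs, h, Int.cast_abs]
    exacts [Admissible.le₂ ‹_›, Admissible.le₁ ‹_›]
  · rw [weight, weight, e₀, hP]

theorem swapLeft (h : Admissible M T ε δ x) :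
    Admissible M T ε δ (swapLeft x) ∧ weight T (_root_.swapLeft x) = weight T x := by
  refine h.of_invariant ?_ ?_ ?_ ?_ ?_ (Or.inl ⟨?_, ?_⟩)
  · intro i; fin_cases i
    exacts [h.ne 1, h.ne 0, h.ne 2, h.ne 3]
  · intro i; fin_cases i
    exacts [h.fst_le 1, h.fst_le 0, h.fst_le 2, h.fst_le 3]
  · intro i; fin_cases i
    exacts [h.snd_le 1, h.snd_le 0, h.snd_le 2, h.snd_le 3]
  · change max (max |x.1 1 * x.1 0| _) (max |x.2 1 * x.2 0| _) = _
    rw [mul_comm (x.1 1), mul_comm (x.2 1)]; rfl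
  · change |x.1 1 * x.1 0 * x.1 2 * x.1 3 - x.2 1 * x.2 0 * x.2 2 * x.2 3| = _
    unfold Δ₀; congr 1; ring
  · change |x.1 1 * x.1 0 * x.2 2 * x.1 3 + x.1 1 * x.1 0 * x.1 2 * x.2 3 -
      x.1 1 * x.2 0 * x.2 2 * x.2 3 - x.2 1 * x.1 0 * x.2 2 * x.2 3| = _
    unfold Δ₁; congr 1; ring
  · change |x.1 1 * x.2 0 * x.1 2 * x.1 3 + x.2 1 * x.1 0 * x.1 2 * x.1 3 -
      x.2 1 * x.2 0 * x.1 2 * x.2 3 - x.2 1 * x.2 0 * x.2 2 * x.1 3| = _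
    unfold Δ₂; congr 1; ring

theorem swapRight (h : Admissible M T ε δ x) :
    Admissible M T ε δ (swapRight x) ∧ weight T (_root_.swapRight x) = weight T x := by
  refine h.of_invariant ?_ ?_ ?_ ?_ ?_ (Or.inl ⟨?_, ?_⟩)
  · intro i; fin_cases i
    exacts [h.ne 0, h.ne 1, h.ne 3, h.ne 2]
  · intro i; fin_cases i
    exacts [h.fst_le 0, h.fst_le 1, h.fst_le 3, h.fst_le 2]
  · intro i; fin_cases i
    exacts [h.snd_le 0, h.snd_le 1, h.snd_le 3, h.snd_le 2]
  · change max (max _ |x.1 3 * x.1 2|) (max _ |x.2 3 * x.2 2|) = _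
    rw [mul_comm (x.1 3), mul_comm (x.2 3)]; rfl
  · change |x.1 0 * x.1 1 * x.1 3 * x.1 2 - x.2 0 * x.2 1 * x.2 3 * x.2 2| = _
    unfold Δ₀; congr 1; ring
  · change |x.1 0 * x.1 1 * x.2 3 * x.1 2 + x.1 0 * x.1 1 * x.1 3 * x.2 2 -
      x.1 0 * x.2 1 * x.2 3 * x.2 2 - x.2 0 * x.1 1 * x.2 3 * x.2 2| = _
    unfold Δ₁; congr 1; ring
  · change |x.1 0 * x.2 1 * x.1 3 * x.1 2 + x.2 0 * x.1 1 * x.1 3 * x.1 2 -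
      x.2 0 * x.2 1 * x.1 3 * x.2 2 - x.2 0 * x.2 1 * x.2 3 * x.1 2| = _
    unfold Δ₂; congr 1; ring

theorem swapHalves (h : Admissible M T ε δ x) :
    Admissible M T ε δ (swapHalves x) ∧ weight T (_root_.swapHalves x) = weight T x := by
  refine h.of_invariant ?_ ?_ ?_ ?_ ?_ (Or.inr ⟨?_, ?_⟩)
  · intro i; fin_cases i
    exacts [h.ne 2, h.ne 3, h.ne 0, h.ne 1]
  · intro i; fin_cases i
    exacts [h.fst_le 2, h.fst_le 3, h.fst_le 0, h.fst_le 1]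
  · intro i; fin_cases i
    exacts [h.snd_le 2, h.snd_le 3, h.snd_le 0, h.snd_le 1]
  · change max (max |x.1 2 * x.1 3| |x.1 0 * x.1 1|) (max |x.2 2 * x.2 3| |x.2 0 * x.2 1|) = _
    rw [max_comm |x.1 2 * x.1 3|, max_comm |x.2 2 * x.2 3|]; rfl
  · change |x.1 2 * x.1 3 * x.1 0 * x.1 1 - x.2 2 * x.2 3 * x.2 0 * x.2 1| = _
    unfold Δ₀; congr 1; ring
  · change |x.1 2 * x.1 3 * x.2 0 * x.1 1 + x.1 2 * x.1 3 * x.1 0 * x.2 1 -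
      x.1 2 * x.2 3 * x.2 0 * x.2 1 - x.2 2 * x.1 3 * x.2 0 * x.2 1| = _
    unfold Δ₂; congr 1; ring
  · change |x.1 2 * x.2 3 * x.1 0 * x.1 1 + x.2 2 * x.1 3 * x.1 0 * x.1 1 -
      x.2 2 * x.2 3 * x.1 0 * x.2 1 - x.2 2 * x.2 3 * x.2 0 * x.1 1| = _
    unfold Δ₁; congr 1; ring

theorem swap (h : Admissible M T ε δ x) :
    Admissible M T ε δ x.swap ∧ weight T x.swap = weight T x := by
  refine h.of_invariant (fun i => (h.ne i).symm) h.snd_le h.fst_le (max_comm _ _)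
    (abs_sub_comm _ _) (Or.inr ⟨?_, ?_⟩)
  · unfold Δ₁ Δ₂
    rw [← abs_neg]
    simp only [Prod.fst_swap, Prod.snd_swap]
    congr 1; ring
  · unfold Δ₁ Δ₂
    rw [← abs_neg]
    simp only [Prod.fst_swap, Prod.snd_swap]
    congr 1; ring

theorem abs_mul_le_Pmax (x : (Fin 4 → ℤ) × (Fin 4 → ℤ)) :
    |x.1 0 * x.1 1| ≤ Pmax x ∧ |x.1 2 * x.1 3| ≤ Pmax x ∧ |x.2 0 * x.2 1| ≤ Pmax x ∧
      |x.2 2 * x.2 3| ≤ Pmax x := by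
  unfold Pmax
  simp

theorem Pmax_le (h : Admissible M T ε δ x) : (Pmax x : ℝ) ≤ M ^ 2 := by
  have ha := fun i j => abs_mul_le_mul (h.fst_le i) (h.fst_le j)
  have hb := fun i j => abs_mul_le_mul (h.snd_le i) (h.snd_le j)
  unfold Pmax
  push_cast
  rw [pow_two]
  exact max_le (max_le (ha 0 1) (ha 2 3)) (max_le (hb 0 1) (hb 2 3))

theorem abs_fst_prod_le (h : Admissible M T ε δ x) :
    |(x.1 0 * x.1 1 * x.1 2 * x.1 3 : ℝ)| ≤ M ^ 4 := by
  have := abs_mul_le_mul (abs_mul_le_mul (abs_mul_le_mul (h.fst_le 0) (h.fst_le 1)) (h.fst_le 2))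
    (h.fst_le 3)
  linarith [show M * M * M * M = M ^ 4 by ring]

theorem abs_snd_prod_le (h : Admissible M T ε δ x) :
    |(x.2 0 * x.2 1 * x.2 2 * x.2 3 : ℝ)| ≤ M ^ 4 := by
  have := abs_mul_le_mul (abs_mul_le_mul (abs_mul_le_mul (h.snd_le 0) (h.snd_le 1)) (h.snd_le 2))
    (h.snd_le 3)
  linarith [show M * M * M * M = M ^ 4 by ring]

theorem abs_Δ₀_le (h : Admissible M T ε δ x) : |(Δ₀ x : ℝ)| ≤ 2 * M ^ 4 := by
  unfold Δ₀
  push_cast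
  have := abs_sub (x.1 0 * x.1 1 * x.1 2 * x.1 3 : ℝ) (x.2 0 * x.2 1 * x.2 2 * x.2 3)
  linarith [h.abs_fst_prod_le, h.abs_snd_prod_le]

theorem weight_le_of_ne_zero (h : Admissible M T ε δ x) (hT : 1 ≤ T) (h₀ : Δ₀ x ≠ 0) :
    weight T x ≤ (T ^ 2)⁻¹ * |(Δ₀ x : ℝ)|⁻¹ := by
  have hP : (0 : ℝ) < Pmax x := by exact_mod_cast h.pos
  have hd : 0 < |(Δ₀ x : ℝ)| := abs_pos.mpr (by exact_mod_cast h₀)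
  rw [weight, ← mul_inv]
  have : 0 ≤ (Pmax x : ℝ) / T := by positivity
  have hT0 : 0 < T := by linarith
  gcongr
  linarith

theorem weight_of_eq_zero (hT : 1 ≤ T) (h₀ : Δ₀ x = 0) :
    weight T x = T⁻¹ * (Pmax x : ℝ)⁻¹ := by
  have hT0 : 0 < T := by linarith
  rw [weight, h₀, ← mul_inv]
  congr 1
  simp only [Int.cast_zero, abs_zero, zero_add]
  field_simp

theorem weight_le_of_eq_zero (hT : 1 ≤ T) (h₀ : Δ₀ x = 0) {c : ℤ}
    (hc : c ≠ 0) (hP : |c| ≤ Pmax x) : weight T x ≤ T⁻¹ * |(c : ℝ)|⁻¹ := by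
  have hc0 : 0 < |(c : ℝ)| := abs_pos.mpr (by exact_mod_cast hc)
  have hP' : |(c : ℝ)| ≤ Pmax x := by exact_mod_cast hP
  have hT0 : 0 < T := by linarith
  rw [weight_of_eq_zero hT h₀]
  gcongr

end Admissible

namespace WeightBound

variable {M T ε δ : ℝ} {p q r : (Fin 4 → ℤ) × (Fin 4 → ℤ) → Prop} {b c : ℝ}

theorem of_forall_imp (h : WeightBound M T ε δ q c) (hpq : ∀ x, Admissible M T ε δ x → p x → q x) :
    WeightBound M T ε δ p c := fun S hS =>
  h S fun x hx => ⟨(hS x hx).1, hpq x (hS x hx).1 (hS x hx).2⟩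

theorem mono (h : WeightBound M T ε δ p b) (hbc : b ≤ c) : WeightBound M T ε δ p c :=
  fun S hS => (h S hS).trans hbc

theorem of_cases (hq : WeightBound M T ε δ q b) (hr : WeightBound M T ε δ r c)
    (hp : ∀ x, Admissible M T ε δ x → p x → q x ∨ r x) : WeightBound M T ε δ p (b + c) := by
  intro S hS
  rw [← Finset.sum_filter_add_sum_filter_not S q]
  refine add_le_add (hq _ fun x hx => ?_) (hr _ fun x hx => ?_)
  · obtain ⟨h1, h2⟩ := Finset.mem_filter.mp hx
    exact ⟨(hS x h1).1, h2⟩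
  · obtain ⟨h1, h2⟩ := Finset.mem_filter.mp hx
    exact ⟨(hS x h1).1, (hp x (hS x h1).1 (hS x h1).2).resolve_left h2⟩

theorem comp (h : WeightBound M T ε δ p c)
    {f : (Fin 4 → ℤ) × (Fin 4 → ℤ) → (Fin 4 → ℤ) × (Fin 4 → ℤ)} (hf : Function.Involutive f)
    (hA : ∀ {x}, Admissible M T ε δ x → Admissible M T ε δ (f x) ∧ weight T (f x) = weight T x) :
    WeightBound M T ε δ (fun x => p (f x)) c := by
  intro S hS
  have := h (S.image f) fun y hy => by
    obtain ⟨x, hx, rfl⟩ := Finset.mem_image.mp hy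
    exact ⟨(hA (hS x hx).1).1, (hS x hx).2⟩
  rw [Finset.sum_image hf.injective.injOn] at this
  calc _ = ∑ x ∈ S, weight T (f x) :=
        Finset.sum_congr rfl fun x hx => (hA (hS x hx).1).2.symm
    _ ≤ c := this

theorem swapLeft (h : WeightBound M T ε δ p c) : WeightBound M T ε δ (fun x => p (swapLeft x)) c :=
  h.comp swapLeft_involutive Admissible.swapLeft

theorem swapRight (h : WeightBound M T ε δ p c) :
    WeightBound M T ε δ (fun x => p (swapRight x)) c :=
  h.comp swapRight_involutive Admissible.swapRight

theorem swapHalves (h : WeightBound M T ε δ p c) :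
    WeightBound M T ε δ (fun x => p (swapHalves x)) c :=
  h.comp swapHalves_involutive Admissible.swapHalves

theorem swap (h : WeightBound M T ε δ p c) : WeightBound M T ε δ (fun x => p x.swap) c :=
  h.comp Prod.swap_swap Admissible.swap

end WeightBound

/-- The three-term bound obeyed by the total weight of each of the families below. -/
noncomputable def familyBound (M T ε κ Λ : ℝ) : ℝ :=
  100 * Λ ^ 6 * (M ^ ε * M ^ 3 / T ^ 2 + M ^ 2 / T + M ^ (4 - κ) / T ^ 2)

theorem mul_pow_mul_le {c Y Z Λ : ℝ} {k : ℕ} (hc : c ≤ 100) (hY : 0 ≤ Y)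
    (hYZ : Y ≤ Z) (hk : k ≤ 6) (hΛ : 1 ≤ Λ) : c * Λ ^ k * Y ≤ 100 * Λ ^ 6 * Z := by
  have := pow_le_pow_right₀ hΛ hk
  gcongr

theorem card_le_one_of_forall_eq {α : Type*} {S : Finset α} (h : ∀ x ∈ S, ∀ y ∈ S, x = y) :
    (S.card : ℝ) ≤ 1 := by
  exact_mod_cast Finset.card_le_one.mpr h

section families

variable {M T ε δ κ Λ : ℝ} (hM : 1 ≤ M) (hT : 1 ≤ T)
  (hΛ : DivisorHarmonicBound (8 * M ^ 4) Λ)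

include hM in
theorem abs_le_of_abs_le_self {t : ℝ} (h : |t| ≤ M) : |t| ≤ 8 * M ^ 4 := by
  have := pow_le_pow_right₀ hM (show 1 ≤ 4 by norm_num)
  rw [pow_one] at this
  linarith [show 0 ≤ M ^ 4 by positivity]

include hM in
theorem abs_le_of_abs_le_two_mul_sq {t : ℝ} (h : |t| ≤ 2 * M ^ 2) : |t| ≤ 8 * M ^ 4 := by
  have := pow_le_pow_right₀ hM (show 2 ≤ 4 by norm_num)
  linarith [show 0 ≤ M ^ 4 by positivity]

theorem abs_le_of_abs_le_two_mul_pow {t : ℝ} (h : |t| ≤ 2 * M ^ 4) : |t| ≤ 8 * M ^ 4 := by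
  linarith [show 0 ≤ M ^ 4 by positivity]

include hM hT in
theorem le_familyBound_fst {t c : ℝ} {j k : ℕ} (hj : j ≤ 3) (hk : k ≤ 6)
    (hc : c ≤ 100) (hΛ1 : 1 ≤ Λ)
    (ht : t ≤ c * Λ ^ k * (M ^ ε * M ^ j / T ^ 2)) : t ≤ familyBound M T ε κ Λ := by
  have hT0 : 0 < T := by linarith
  have hM0 : 0 < M := by linarith
  have h1 : M ^ j ≤ M ^ 3 := pow_le_pow_right₀ hM hj
  have h2 : 0 ≤ M ^ ε := by positivity
  have h3 : 0 ≤ M ^ 2 / T := by positivity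
  have h4 : 0 ≤ M ^ (4 - κ) / T ^ 2 := by positivity
  refine ht.trans (mul_pow_mul_le hc (by positivity) ?_ hk hΛ1)
  have : M ^ ε * M ^ j / T ^ 2 ≤ M ^ ε * M ^ 3 / T ^ 2 := by gcongr
  linarith

include hM hT in
theorem le_familyBound_snd {t c : ℝ} {k : ℕ} (hk : k ≤ 6) (hc : c ≤ 100)
    (hΛ1 : 1 ≤ Λ) (ht : t ≤ c * Λ ^ k * (M ^ 2 / T)) : t ≤ familyBound M T ε κ Λ := by
  have hT0 : 0 < T := by linarith
  have hM0 : 0 < M := by linarith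
  have h3 : 0 ≤ M ^ ε * M ^ 3 / T ^ 2 := by positivity
  have h4 : 0 ≤ M ^ (4 - κ) / T ^ 2 := by positivity
  exact ht.trans (mul_pow_mul_le hc (by positivity) (by linarith) hk hΛ1)

include hM hT in
theorem le_familyBound_trd {t c : ℝ} {k : ℕ} (hk : k ≤ 6) (hc : c ≤ 100)
    (hΛ1 : 1 ≤ Λ) (ht : t ≤ c * Λ ^ k * (M ^ (4 - κ) / T ^ 2)) : t ≤ familyBound M T ε κ Λ := by
  have hT0 : 0 < T := by linarith
  have hM0 : 0 < M := by linarith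
  have h3 : 0 ≤ M ^ ε * M ^ 3 / T ^ 2 := by positivity
  have h4 : 0 ≤ M ^ 2 / T := by positivity
  exact ht.trans (mul_pow_mul_le hc (by positivity) (by linarith) hk hΛ1)

include hΛ in
/-- There are few choices of `b₁, …, b₄` with a given nonzero product. -/
theorem card_le_of_snd_prod_eq {S : Finset ((Fin 4 → ℤ) × (Fin 4 → ℤ))} {n : ℤ} (hn : n ≠ 0)
    (hnM : |(n : ℝ)| ≤ M ^ 4) {a : Fin 4 → ℤ} (ha : ∀ x ∈ S, x.1 = a)
    (hb : ∀ x ∈ S, x.2 0 * x.2 1 * x.2 2 * x.2 3 = n) : (S.card : ℝ) ≤ Λ ^ 3 := by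
  refine card_le_pow_of_dvd hΛ S (fun x => ![x.2 0, x.2 1, x.2 2]) (fun _ => n) (fun _ => hn)
    (fun _ => ?_) ?_ ?_
  · exact abs_le_of_abs_le_two_mul_pow (by linarith [abs_nonneg (n : ℝ)])
  · intro x hx i
    rw [← hb x hx]
    fin_cases i
    exacts [⟨x.2 1 * x.2 2 * x.2 3, by simp; ring⟩, ⟨x.2 0 * x.2 2 * x.2 3, by simp; ring⟩,
      ⟨x.2 0 * x.2 1 * x.2 3, by simp; ring⟩]
  · intro x hx y hy h
    have h0 : x.2 0 = y.2 0 := congrFun h 0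
    have h1 : x.2 1 = y.2 1 := congrFun h 1
    have h2 : x.2 2 = y.2 2 := congrFun h 2
    have ex := hb x hx
    have ey := hb y hy
    have hne : y.2 0 * y.2 1 * y.2 2 ≠ 0 := left_ne_zero_of_mul (ey ▸ hn)
    have h3 : x.2 3 = y.2 3 := by
      rw [h0, h1, h2] at ex
      exact mul_left_cancel₀ hne (ex.trans ey.symm)
    have hxy : x.1 = y.1 := (ha x hx).trans (ha y hy).symm
    exact tuple_ext (by rw [hxy]) (by rw [hxy]) (by rw [hxy]) (by rw [hxy]) h0 h1 h2 h3

include hM hT hΛ in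
theorem weightBound_of_Δ₀_eq_zero :
    WeightBound M T ε δ (fun x => Δ₀ x = 0 ∧ ∀ i, x.1 i ≠ 0) (familyBound M T ε κ Λ) := by
  intro S hS
  have hM0 : 0 < M := by linarith
  have hT0 : 0 < T := by linarith
  refine (sum_le_of_fibers hΛ S (weight T) (fun x => ![x.1 0, x.1 1]) (fun x => ![x.1 2, x.1 3])
    (fun _ => M) (K := T⁻¹) (F := Λ ^ 3) (by positivity) (fun _ => hM) ?_ ?_ ?_
    (pow_nonneg (zero_le_one.trans hΛ.one_le) _) ?_).trans ?_
  · intro x hx i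
    have h := (hS x hx).1
    fin_cases i
    exacts [abs_le_of_abs_le_self hM (h.fst_le 0), abs_le_of_abs_le_self hM (h.fst_le 1)]
  · intro x hx i
    have h := (hS x hx).1
    fin_cases i
    exacts [h.fst_le 2, h.fst_le 3]
  · intro x hx
    obtain ⟨h, h0, ha⟩ := hS x hx
    have := Admissible.weight_le_of_eq_zero hT h0 (mul_ne_zero (ha 0) (ha 1))
      (Admissible.abs_mul_le_Pmax x).1
    simpa [Fin.prod_univ_succ, abs_mul, mul_comm] using this
  · intro x₀ h₀ S' hS' hc
    obtain ⟨hA, h0, ha⟩ := hS x₀ h₀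
    have hn : x₀.1 0 * x₀.1 1 * x₀.1 2 * x₀.1 3 ≠ 0 :=
      mul_ne_zero (mul_ne_zero (mul_ne_zero (ha 0) (ha 1)) (ha 2)) (ha 3)
    have hfst : ∀ x ∈ S', x.1 = x₀.1 := fun x hx => by
      obtain ⟨h1, h2⟩ := hc x hx
      funext i
      fin_cases i
      exacts [congrFun h1 0, congrFun h1 1, congrFun h2 0, congrFun h2 1]
    refine card_le_of_snd_prod_eq hΛ hn (by exact_mod_cast hA.abs_fst_prod_le) hfst
      fun x hx => ?_
    have := (hS x (hS' hx)).2.1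
    rw [Δ₀, hfst x hx] at this
    linarith
  · refine le_familyBound_snd hM hT (c := 9) (k := 5) (by norm_num) (by norm_num)
      hΛ.one_le ?_
    simp only [Fin.prod_univ_two]
    refine le_of_eq ?_
    field_simp
    ring

include hM hT hΛ in
theorem weightBound_of_zero_same_half_aux :
    WeightBound M T ε δ (fun x => (x.1 0 = 0 ∧ x.2 1 = 0) ∧ |x.1 2 * x.1 3| = Pmax x)
      (familyBound M T ε κ Λ) := by
  intro S hS
  have hM0 : 0 < M := by linarith
  have hT0 : 0 < T := by linarith
  refine (sum_le_of_fibers hΛ S (weight T) (fun x => ![x.2 0, x.1 1, x.1 2, x.1 3])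
    (fun x => ![x.2 2, x.2 3])
    (fun _ => M) (K := (T ^ 2)⁻¹ * M ^ ε) (F := 1) (by positivity) (fun _ => hM) ?_ ?_ ?_
    zero_le_one ?_).trans ?_
  · intro x hx i
    have h := (hS x hx).1
    fin_cases i
    exacts [abs_le_of_abs_le_self hM (h.snd_le 0), abs_le_of_abs_le_self hM (h.fst_le 1),
      abs_le_of_abs_le_self hM (h.fst_le 2), abs_le_of_abs_le_self hM (h.fst_le 3)]
  · intro x hx i
    have h := (hS x hx).1
    fin_cases i
    exacts [h.snd_le 2, h.snd_le 3]
  · intro x hx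
    obtain ⟨h, ⟨ha, hb⟩, hP⟩ := hS x hx
    have hΔ : Δ₀ x = 0 := by rw [Δ₀, ha, hb]; ring
    have hΔ₂ : Δ₂ x = x.2 0 * x.1 1 * (x.1 2 * x.1 3) := by rw [Δ₂, ha, hb]; ring
    have hP0 : (0 : ℝ) < Pmax x := by exact_mod_cast h.pos
    have hPr : |(x.1 2 : ℝ) * x.1 3| = Pmax x := by exact_mod_cast hP
    have hb0 : 0 < |(x.2 0 : ℝ)| :=
      abs_pos.mpr (by exact_mod_cast (h.ne 0).resolve_left (not_not.mpr ha))
    have ha1 : 0 < |(x.1 1 : ℝ)| :=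
      abs_pos.mpr (by exact_mod_cast (h.ne 1).resolve_right (not_not.mpr hb))
    have hle := h.le₂
    rw [hΔ, hΔ₂] at hle
    push_cast at hle
    rw [abs_mul, hPr, abs_zero, zero_add, abs_mul] at hle
    have hle' : |(x.2 0 : ℝ)| * |(x.1 1 : ℝ)| * T ≤ M ^ ε := by
      rw [← mul_div_assoc, le_div_iff₀ hT0] at hle
      refine le_of_mul_le_mul_right ?_ hP0
      linarith
    rw [Admissible.weight_of_eq_zero hT hΔ]
    simp only [Fin.prod_univ_succ, Fin.prod_univ_zero]
    change _ ≤ (T ^ 2)⁻¹ * M ^ ε * (|(x.2 0 : ℝ)|⁻¹ * (|(x.1 1 : ℝ)|⁻¹ * (|(x.1 2 : ℝ)|⁻¹ *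
      (|(x.1 3 : ℝ)|⁻¹ * 1))))
    have e : |(x.1 2 : ℝ)|⁻¹ * (|(x.1 3 : ℝ)|⁻¹ * 1) = (Pmax x : ℝ)⁻¹ := by
      rw [mul_one, ← mul_inv, ← abs_mul, hPr]
    rw [e, ← mul_assoc, ← mul_assoc]
    gcongr
    have : T⁻¹ = (T ^ 2)⁻¹ * (|(x.2 0 : ℝ)| * |(x.1 1 : ℝ)| * T) * |(x.2 0 : ℝ)|⁻¹ *
        |(x.1 1 : ℝ)|⁻¹ := by
      field_simp
    rw [this]
    gcongr
  · intro x₀ h₀ S' hS' hc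
    refine card_le_one_of_forall_eq fun x hx y hy => ?_
    have hz : ∀ z ∈ S', z = x₀ := fun z hz => by
      obtain ⟨h1, h2⟩ := hc z hz
      have e1 := (hS z (hS' hz)).2.1
      have e2 := (hS x₀ h₀).2.1
      exact tuple_ext (e1.1.trans e2.1.symm) (congrFun h1 1) (congrFun h1 2) (congrFun h1 3)
        (congrFun h1 0) (e1.2.trans e2.2.symm) (congrFun h2 0) (congrFun h2 1)
    rw [hz x hx, hz y hy]
  · refine le_familyBound_fst hM hT (c := 9) (j := 2) (k := 4) (by norm_num) (by norm_num)
      (by norm_num) hΛ.one_le ?_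
    simp only [Fin.prod_univ_two]
    refine le_of_eq ?_
    field_simp
    ring

include hM hT hΛ in
theorem weightBound_of_zero_same_half :
    WeightBound M T ε δ (fun x => x.1 0 = 0 ∧ x.2 1 = 0) (2 * familyBound M T ε κ Λ) := by
  have h := weightBound_of_zero_same_half_aux (ε := ε) (δ := δ) (κ := κ) hM hT hΛ
  refine (h.of_cases (h.swap.swapLeft) fun x hx hp => ?_).mono (by linarith)
  have hP : Pmax x = max |x.1 2 * x.1 3| |x.2 2 * x.2 3| := by
    rw [Pmax, hp.1, hp.2, zero_mul, mul_zero, abs_zero, max_eq_right (abs_nonneg (x.1 2 * x.1 3)),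
      max_eq_right (abs_nonneg (x.2 2 * x.2 3))]
  rcases le_total |x.1 2 * x.1 3| |x.2 2 * x.2 3| with h | h
  · right
    have e : Pmax (swapLeft x).swap = Pmax x := by
      simp [Pmax, swapLeft, mul_comm, max_comm]
    refine ⟨⟨hp.2, hp.1⟩, ?_⟩
    rw [e, hP, max_eq_right h]
    rfl
  · left
    exact ⟨hp, by rw [hP, max_eq_left h]⟩

include hM hT hΛ in
theorem weightBound_of_zero_diff_half_of_ne :
    WeightBound M T ε δ (fun x => (x.1 0 = 0 ∧ x.2 2 = 0) ∧
      x.1 1 * x.1 3 - x.2 1 * x.2 3 ≠ 0 ∧ x.1 1 ≠ 0) (familyBound M T ε κ Λ) := by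
  intro S hS
  have hM0 : 0 < M := by linarith
  have hT0 : 0 < T := by linarith
  refine (sum_le_of_fibers hΛ S (weight T)
    (fun x => ![x.2 0, x.1 2, x.1 1 * x.1 3 - x.2 1 * x.2 3])
    (fun x => ![x.1 1, x.2 1, x.2 3])
    (fun _ => M) (K := (T ^ 2)⁻¹ * M ^ ε) (F := 1) (by positivity) (fun _ => hM) ?_ ?_ ?_
    zero_le_one ?_).trans ?_
  · intro x hx i
    have h := (hS x hx).1
    have hk : |((x.1 1 * x.1 3 - x.2 1 * x.2 3 : ℤ) : ℝ)| ≤ 8 * M ^ 4 := by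
      refine abs_le_of_abs_le_two_mul_sq hM ?_
      push_cast
      have h1 := abs_mul_le_mul (h.fst_le 1) (h.fst_le 3)
      have h2 := abs_mul_le_mul (h.snd_le 1) (h.snd_le 3)
      have h3 := abs_sub (x.1 1 * x.1 3 : ℝ) (x.2 1 * x.2 3)
      linarith [sq M]
    fin_cases i
    exacts [abs_le_of_abs_le_self hM (h.snd_le 0), abs_le_of_abs_le_self hM (h.fst_le 2), hk]
  · intro x hx i
    have h := (hS x hx).1
    fin_cases i
    exacts [h.fst_le 1, h.snd_le 1, h.snd_le 3]
  · intro x hx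
    obtain ⟨h, ⟨ha, hb⟩, hk, -⟩ := hS x hx
    have hΔ : Δ₀ x = 0 := by rw [Δ₀, ha, hb]; ring
    have hΔ₂ : Δ₂ x = x.2 0 * x.1 2 * (x.1 1 * x.1 3 - x.2 1 * x.2 3) := by
      rw [Δ₂, ha, hb]; ring
    have hP0 : (0 : ℝ) < Pmax x := by exact_mod_cast h.pos
    have hb0 : 0 < |(x.2 0 : ℝ)| :=
      abs_pos.mpr (by exact_mod_cast (h.ne 0).resolve_left (not_not.mpr ha))
    have ha2 : 0 < |(x.1 2 : ℝ)| :=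
      abs_pos.mpr (by exact_mod_cast (h.ne 2).resolve_right (not_not.mpr hb))
    have hle := h.le₂
    rw [hΔ, hΔ₂, Int.cast_zero, abs_zero, zero_add] at hle
    set k := x.1 1 * x.1 3 - x.2 1 * x.2 3
    have hk0 : 0 < |(k : ℝ)| := abs_pos.mpr (by exact_mod_cast hk)
    push_cast at hle
    rw [abs_mul, abs_mul, ← mul_div_assoc, le_div_iff₀ hT0] at hle
    rw [Admissible.weight_of_eq_zero hT hΔ]
    simp only [Fin.prod_univ_succ, Fin.prod_univ_zero]
    change _ ≤ (T ^ 2)⁻¹ * M ^ ε * (|(x.2 0 : ℝ)|⁻¹ * (|(x.1 2 : ℝ)|⁻¹ * (|(k : ℝ)|⁻¹ * 1)))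
    have e : T⁻¹ * (Pmax x : ℝ)⁻¹ = (T ^ 2)⁻¹ * (Pmax x : ℝ)⁻¹ *
        (|(x.2 0 : ℝ)| * |(x.1 2 : ℝ)| * |(k : ℝ)| * T) *
        (|(x.2 0 : ℝ)|⁻¹ * (|(x.1 2 : ℝ)|⁻¹ * (|(k : ℝ)|⁻¹ * 1))) := by
      field_simp
    rw [e]
    refine mul_le_mul_of_nonneg_right ?_ (by positivity)
    calc _ ≤ (T ^ 2)⁻¹ * (Pmax x : ℝ)⁻¹ * (M ^ ε * Pmax x) := by gcongr
      _ = _ := by field_simp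
  · intro x₀ h₀ S' hS' hc
    refine card_le_one_of_forall_eq fun x hx y hy => ?_
    have hz : ∀ z ∈ S', z = x₀ := fun z hz => by
      obtain ⟨h1, h2⟩ := hc z hz
      have e1 := (hS z (hS' hz)).2.1
      obtain ⟨e2, -, e3⟩ := (hS x₀ h₀).2
      have a1 : z.1 1 = x₀.1 1 := congrFun h2 0
      have b1 : z.2 1 = x₀.2 1 := congrFun h2 1
      have b3 : z.2 3 = x₀.2 3 := congrFun h2 2
      have hk : z.1 1 * z.1 3 - z.2 1 * z.2 3 = x₀.1 1 * x₀.1 3 - x₀.2 1 * x₀.2 3 :=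
        congrFun h1 2
      rw [a1, b1, b3] at hk
      have a3 : z.1 3 = x₀.1 3 := mul_left_cancel₀ e3 (by linarith)
      exact tuple_ext (e1.1.trans e2.1.symm) a1 (congrFun h1 1) a3
        (congrFun h1 0) b1 (e1.2.trans e2.2.symm) b3
    rw [hz x hx, hz y hy]
  · refine le_familyBound_fst hM hT (c := 27) (j := 3) (k := 3) (by norm_num) (by norm_num)
      (by norm_num) hΛ.one_le ?_
    simp only [Fin.prod_univ_three]
    refine le_of_eq ?_
    field_simp
    ring

include hM hT hΛ in
theorem weightBound_of_zero_diff_half_of_eq_of_ne :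
    WeightBound M T ε δ (fun x => (x.1 0 = 0 ∧ x.2 2 = 0) ∧
      x.1 1 * x.1 3 = x.2 1 * x.2 3 ∧ x.2 1 ≠ 0 ∧ x.2 3 ≠ 0) (familyBound M T ε κ Λ) := by
  intro S hS
  have hM0 : 0 < M := by linarith
  have hT0 : 0 < T := by linarith
  refine (sum_le_of_fibers hΛ S (weight T) (fun x => ![x.2 0, x.2 1]) (fun x => ![x.1 2, x.2 3])
    (fun _ => M) (K := T⁻¹) (F := Λ ^ 1) (by positivity) (fun _ => hM) ?_ ?_ ?_
    (pow_nonneg (zero_le_one.trans hΛ.one_le) _) ?_).trans ?_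
  · intro x hx i
    have h := (hS x hx).1
    fin_cases i
    exacts [abs_le_of_abs_le_self hM (h.snd_le 0), abs_le_of_abs_le_self hM (h.snd_le 1)]
  · intro x hx i
    have h := (hS x hx).1
    fin_cases i
    exacts [h.fst_le 2, h.snd_le 3]
  · intro x hx
    obtain ⟨h, ⟨ha, hb⟩, -, hb1, -⟩ := hS x hx
    have hΔ : Δ₀ x = 0 := by rw [Δ₀, ha, hb]; ring
    have := Admissible.weight_le_of_eq_zero hT hΔ
      (mul_ne_zero ((h.ne 0).resolve_left (not_not.mpr ha)) hb1)
      (Admissible.abs_mul_le_Pmax x).2.2.1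
    simpa [Fin.prod_univ_succ, abs_mul, mul_comm] using this
  · intro x₀ h₀ S' hS' hc
    obtain ⟨hA, hab, hk, hb1, hb3⟩ := hS x₀ h₀
    have heq : ∀ x ∈ S', x.1 1 * x.1 3 = x₀.2 1 * x₀.2 3 ∧ x.1 2 = x₀.1 2 ∧ x.2 = x₀.2 := by
      intro x hx
      obtain ⟨h1, h2⟩ := hc x hx
      have hx' := (hS x (hS' hx)).2
      have b1 : x.2 1 = x₀.2 1 := congrFun h1 1
      have b3 : x.2 3 = x₀.2 3 := congrFun h2 1
      refine ⟨by rw [hx'.2.1, b1, b3], congrFun h2 0, funext fun i => ?_⟩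
      fin_cases i
      exacts [congrFun h1 0, b1, hx'.1.2.trans hab.2.symm, b3]
    refine card_le_pow_of_dvd hΛ S' (fun x => ![x.1 1]) (fun _ => x₀.2 1 * x₀.2 3)
      (fun _ => mul_ne_zero hb1 hb3) (fun _ => abs_le_of_abs_le_two_mul_sq hM ?_) ?_ ?_
    · push_cast
      nlinarith [abs_mul_le_mul (hA.snd_le 1) (hA.snd_le 3)]
    · intro x hx i
      fin_cases i
      exact ⟨x.1 3, (heq x hx).1.symm⟩
    · intro x hx y hy h
      have a1 : x.1 1 = y.1 1 := congrFun h 0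
      have ex := heq x hx
      have ey := heq y hy
      have hb : x.2 = y.2 := ex.2.2.trans ey.2.2.symm
      have hy1 : y.1 1 ≠ 0 := left_ne_zero_of_mul (ey.1 ▸ mul_ne_zero hb1 hb3)
      have a3 : x.1 3 = y.1 3 := by
        refine mul_left_cancel₀ hy1 ?_
        rw [ey.1, ← ex.1, a1]
      exact tuple_ext ((hS x (hS' hx)).2.1.1.trans (hS y (hS' hy)).2.1.1.symm) a1
        (ex.2.1.trans ey.2.1.symm) a3 (by rw [hb]) (by rw [hb]) (by rw [hb]) (by rw [hb])
  · refine le_familyBound_snd hM hT (c := 9) (k := 3) (by norm_num) (by norm_num)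
      hΛ.one_le ?_
    simp only [Fin.prod_univ_two]
    refine le_of_eq ?_
    field_simp
    ring

include hM hT hΛ in
theorem weightBound_of_zero_diff_half_of_four_zeros :
    WeightBound M T ε δ (fun x => (x.1 0 = 0 ∧ x.2 2 = 0) ∧
      x.1 1 = 0 ∧ x.2 1 ≠ 0 ∧ x.2 3 = 0) (familyBound M T ε κ Λ) := by
  intro S hS
  have hM0 : 0 < M := by linarith
  have hT0 : 0 < T := by linarith
  refine (sum_le_of_fibers hΛ S (weight T) (fun x => ![x.2 0, x.2 1]) (fun x => ![x.1 2, x.1 3])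
    (fun _ => M) (K := T⁻¹) (F := 1) (by positivity) (fun _ => hM) ?_ ?_ ?_
    zero_le_one ?_).trans ?_
  · intro x hx i
    have h := (hS x hx).1
    fin_cases i
    exacts [abs_le_of_abs_le_self hM (h.snd_le 0), abs_le_of_abs_le_self hM (h.snd_le 1)]
  · intro x hx i
    have h := (hS x hx).1
    fin_cases i
    exacts [h.fst_le 2, h.fst_le 3]
  · intro x hx
    obtain ⟨h, ⟨ha, hb⟩, -, hb1, -⟩ := hS x hx
    have hΔ : Δ₀ x = 0 := by rw [Δ₀, ha, hb]; ring
    have := Admissible.weight_le_of_eq_zero hT hΔ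
      (mul_ne_zero ((h.ne 0).resolve_left (not_not.mpr ha)) hb1)
      (Admissible.abs_mul_le_Pmax x).2.2.1
    simpa [Fin.prod_univ_succ, abs_mul, mul_comm] using this
  · intro x₀ h₀ S' hS' hc
    refine card_le_one_of_forall_eq fun x hx y hy => ?_
    have hz : ∀ z ∈ S', z = x₀ := fun z hz => by
      obtain ⟨h1, h2⟩ := hc z hz
      obtain ⟨e1, f1, -, g1⟩ := (hS z (hS' hz)).2
      obtain ⟨e2, f2, -, g2⟩ := (hS x₀ h₀).2
      exact tuple_ext (e1.1.trans e2.1.symm) (f1.trans f2.symm) (congrFun h2 0) (congrFun h2 1)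
        (congrFun h1 0) (congrFun h1 1) (e1.2.trans e2.2.symm) (g1.trans g2.symm)
    rw [hz x hx, hz y hy]
  · refine le_familyBound_snd hM hT (c := 9) (k := 2) (by norm_num) (by norm_num)
      hΛ.one_le ?_
    simp only [Fin.prod_univ_two]
    refine le_of_eq ?_
    field_simp
    ring

include hM hT hΛ in
theorem weightBound_of_zero_diff_half :
    WeightBound M T ε δ (fun x => x.1 0 = 0 ∧ x.2 2 = 0) (4 * familyBound M T ε κ Λ) := by
  have h₁ := weightBound_of_zero_diff_half_of_ne (ε := ε) (δ := δ) (κ := κ) hM hT hΛ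
  have h₂ := weightBound_of_zero_diff_half_of_eq_of_ne (ε := ε) (δ := δ) (κ := κ) hM hT hΛ
  have h₃ := weightBound_of_zero_diff_half_of_four_zeros (ε := ε) (δ := δ) (κ := κ) hM hT hΛ
  have h₁' := (h₁.of_cases h₁.swap.swapHalves fun x _ hp => hp :
    WeightBound M T ε δ (fun x => _ ∨ _) _)
  have h₂₃ := (h₂.of_cases h₃ fun x _ hp => hp : WeightBound M T ε δ (fun x => _ ∨ _) _)
  refine (h₁'.of_cases h₂₃ fun x hx hp => ?_).mono (by linarith)
  by_cases hk : x.1 1 * x.1 3 - x.2 1 * x.2 3 = 0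
  · right
    have ha3 : x.2 3 = 0 → x.1 3 ≠ 0 := fun h => (hx.ne 3).resolve_right (not_not.mpr h)
    have hb1 : x.2 1 ≠ 0 := by
      intro hb1
      have ha1 := (hx.ne 1).resolve_right (not_not.mpr hb1)
      rw [hb1, zero_mul, sub_zero] at hk
      have ha3 := (mul_eq_zero.mp hk).resolve_left ha1
      have := hx.pos
      rw [Pmax, hp.1, hp.2, hb1, ha3] at this
      simp at this
    by_cases hb3 : x.2 3 = 0
    · right
      rw [hb3, mul_zero, sub_zero] at hk
      exact ⟨hp, (mul_eq_zero.mp hk).resolve_right (ha3 hb3), hb1, hb3⟩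
    · left
      exact ⟨hp, by linarith, hb1, hb3⟩
  · left
    by_cases ha1 : x.1 1 = 0
    · right
      refine ⟨⟨hp.2, hp.1⟩, fun h => hk ?_, fun h => hk ?_⟩
      · change x.2 3 * x.2 1 - x.1 3 * x.1 1 = 0 at h
        linarith
      · change x.2 3 = 0 at h
        rw [ha1, h]; ring
    · left
      exact ⟨hp, hk, ha1⟩

theorem Δ₀_swapLeft (x : (Fin 4 → ℤ) × (Fin 4 → ℤ)) : Δ₀ (swapLeft x) = Δ₀ x := by
  change x.1 1 * x.1 0 * x.1 2 * x.1 3 - x.2 1 * x.2 0 * x.2 2 * x.2 3 = _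
  unfold Δ₀; ring

theorem Δ₀_swapRight (x : (Fin 4 → ℤ) × (Fin 4 → ℤ)) : Δ₀ (swapRight x) = Δ₀ x := by
  change x.1 0 * x.1 1 * x.1 3 * x.1 2 - x.2 0 * x.2 1 * x.2 3 * x.2 2 = _
  unfold Δ₀; ring

theorem Δ₀_swapHalves (x : (Fin 4 → ℤ) × (Fin 4 → ℤ)) : Δ₀ (swapHalves x) = Δ₀ x := by
  change x.1 2 * x.1 3 * x.1 0 * x.1 1 - x.2 2 * x.2 3 * x.2 0 * x.2 1 = _
  unfold Δ₀; ring

theorem Δ₀_swap (x : (Fin 4 → ℤ) × (Fin 4 → ℤ)) : Δ₀ x.swap = -Δ₀ x := by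
  simp [Δ₀]

include hM hT hΛ in
theorem weightBound_of_Δ₀_ne_zero_of_eq_zero (hε : 0 < ε) :
    WeightBound M T ε δ (fun x => Δ₀ x ≠ 0 ∧ x.1 0 = 0) (familyBound M T ε κ Λ) := by
  intro S hS
  have hM0 : 0 < M := by linarith
  have hT0 : 0 < T := by linarith
  refine (sum_le_of_fibers hΛ S (weight T) (fun x => ![Δ₀ x]) (fun x => ![x.1 1, x.1 2, x.1 3])
    (fun _ => M) (K := (T ^ 2)⁻¹) (F := Λ ^ 3) (by positivity) (fun _ => hM) ?_ ?_ ?_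
    (pow_nonneg (zero_le_one.trans hΛ.one_le) _) ?_).trans ?_
  · intro x hx i
    have h := (hS x hx).1
    fin_cases i
    exact abs_le_of_abs_le_two_mul_pow h.abs_Δ₀_le
  · intro x hx i
    have h := (hS x hx).1
    fin_cases i
    exacts [h.fst_le 1, h.fst_le 2, h.fst_le 3]
  · intro x hx
    obtain ⟨h, h0, -⟩ := hS x hx
    simpa using h.weight_le_of_ne_zero hT h0
  · intro x₀ h₀ S' hS' hc
    obtain ⟨hA, h0, ha⟩ := hS x₀ h₀
    have hprod : ∀ x ∈ S, x.2 0 * x.2 1 * x.2 2 * x.2 3 = -Δ₀ x := fun x hx => by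
      rw [Δ₀, (hS x hx).2.2]; ring
    have hfst : ∀ x ∈ S', x.1 = x₀.1 := fun x hx => by
      obtain ⟨h1, h2⟩ := hc x hx
      funext i
      fin_cases i
      exacts [(hS x (hS' hx)).2.2.trans ha.symm, congrFun h2 0, congrFun h2 1, congrFun h2 2]
    refine card_le_of_snd_prod_eq hΛ (neg_ne_zero.mpr h0) ?_ hfst fun x hx => ?_
    · rw [← hprod x₀ h₀]
      exact_mod_cast hA.abs_snd_prod_le
    · rw [hprod x (hS' hx)]
      exact congrArg Neg.neg (congrFun (hc x hx).1 0)
  · refine le_familyBound_fst hM hT (c := 27) (j := 3) (k := 4) (by norm_num) (by norm_num)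
      (by norm_num) hΛ.one_le ?_
    have h1 : 1 ≤ M ^ ε := Real.one_le_rpow hM hε.le
    have hΛ0 : 0 ≤ Λ := zero_le_one.trans hΛ.one_le
    calc _ = 27 * Λ ^ 4 * (1 * M ^ 3 / T ^ 2) := by
          simp only [Fin.prod_univ_three]
          field_simp
          ring
      _ ≤ _ := by gcongr

include hM hT hΛ in
theorem weightBound_of_Δ₀_ne_zero_of_small (hκ : κ ≤ 1) :
    WeightBound M T ε δ (fun x => Δ₀ x ≠ 0 ∧ (∀ i, x.2 i ≠ 0) ∧ |(x.1 1 : ℝ)| ≤ M ^ (1 - κ))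
      (familyBound M T ε κ Λ) := by
  intro S hS
  have hM0 : 0 < M := by linarith
  have hT0 : 0 < T := by linarith
  refine (sum_le_of_fibers hΛ S (weight T) (fun x => ![Δ₀ x])
    (fun x => ![x.1 0, x.1 1, x.1 2, x.1 3])
    ![M, M ^ (1 - κ), M, M] (K := (T ^ 2)⁻¹) (F := Λ ^ 3) (by positivity) ?_ ?_ ?_ ?_
    (pow_nonneg (zero_le_one.trans hΛ.one_le) _) ?_).trans ?_
  · intro i
    fin_cases i
    exacts [hM, Real.one_le_rpow hM (by linarith), hM, hM]
  · intro x hx i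
    have h := (hS x hx).1
    fin_cases i
    exact abs_le_of_abs_le_two_mul_pow h.abs_Δ₀_le
  · intro x hx i
    have h := (hS x hx).1
    fin_cases i
    exacts [h.fst_le 0, (hS x hx).2.2.2, h.fst_le 2, h.fst_le 3]
  · intro x hx
    obtain ⟨h, h0, -⟩ := hS x hx
    simpa using h.weight_le_of_ne_zero hT h0
  · intro x₀ h₀ S' hS' hc
    obtain ⟨hA, h0, hb, -⟩ := hS x₀ h₀
    have hfst : ∀ x ∈ S', x.1 = x₀.1 := fun x hx => by
      obtain ⟨h1, h2⟩ := hc x hx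
      funext i
      fin_cases i
      exacts [congrFun h2 0, congrFun h2 1, congrFun h2 2, congrFun h2 3]
    have hn : x₀.2 0 * x₀.2 1 * x₀.2 2 * x₀.2 3 ≠ 0 :=
      mul_ne_zero (mul_ne_zero (mul_ne_zero (hb 0) (hb 1)) (hb 2)) (hb 3)
    refine card_le_of_snd_prod_eq hΛ hn (by exact_mod_cast hA.abs_snd_prod_le) hfst
      fun x hx => ?_
    have hΔ : Δ₀ x = Δ₀ x₀ := congrFun (hc x hx).1 0
    rw [Δ₀, Δ₀, hfst x hx] at hΔ
    linarith
  · refine le_familyBound_trd hM hT (c := 81) (k := 4) (by norm_num) (by norm_num) hΛ.one_le ?_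
    have e : M ^ (4 - κ) = M ^ 3 * M ^ (1 - κ) := by
      rw [← Real.rpow_natCast, ← Real.rpow_add hM0]
      congr 1; push_cast; ring
    rw [e]
    simp only [Fin.prod_univ_four]
    change (T ^ 2)⁻¹ * Λ ^ 3 * Λ ^ 1 * (3 * M * (3 * M ^ (1 - κ)) * (3 * M) * (3 * M)) ≤ _
    refine le_of_eq ?_
    field_simp
    ring

include hM hΛ in
/-- There are few tuples with nonzero entries for which `a₁a₃`, `a₂a₄`, `b₁b₃`, `b₂b₄` are
prescribed. -/
theorem card_le_of_cross_prod_eq {S : Finset ((Fin 4 → ℤ) × (Fin 4 → ℤ))} {u v X Y : ℤ}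
    (hA : ∀ x ∈ S, Admissible M T ε δ x) (hne : ∀ x ∈ S, ∀ i, x.1 i ≠ 0 ∧ x.2 i ≠ 0)
    (hS : ∀ x ∈ S, x.1 0 * x.1 2 = u ∧ x.1 1 * x.1 3 = X ∧ x.2 0 * x.2 2 = v ∧
      x.2 1 * x.2 3 = Y) : (S.card : ℝ) ≤ Λ ^ 4 := by
  rcases S.eq_empty_or_nonempty with rfl | ⟨x₀, h₀⟩
  · have := zero_le_one.trans hΛ.one_le
    simpa using pow_nonneg this 4
  obtain ⟨hu, hX, hv, hY⟩ := hS x₀ h₀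
  have hn := hne x₀ h₀
  have hA₀ := hA x₀ h₀
  have hcast : ∀ s t : ℤ, |(s : ℝ)| ≤ M → |(t : ℝ)| ≤ M → |((s * t : ℤ) : ℝ)| ≤ 8 * M ^ 4 := by
    intro s t hs ht
    refine abs_le_of_abs_le_two_mul_sq hM ?_
    push_cast
    nlinarith [abs_mul_le_mul hs ht]
  refine card_le_pow_of_dvd hΛ S (fun x => ![x.1 0, x.1 1, x.2 0, x.2 1]) ![u, X, v, Y]
    ?_ ?_ ?_ ?_
  · intro i
    fin_cases i
    exacts [hu ▸ mul_ne_zero (hn 0).1 (hn 2).1, hX ▸ mul_ne_zero (hn 1).1 (hn 3).1,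
      hv ▸ mul_ne_zero (hn 0).2 (hn 2).2, hY ▸ mul_ne_zero (hn 1).2 (hn 3).2]
  · intro i
    fin_cases i
    exacts [hu ▸ hcast _ _ (hA₀.fst_le 0) (hA₀.fst_le 2),
      hX ▸ hcast _ _ (hA₀.fst_le 1) (hA₀.fst_le 3),
      hv ▸ hcast _ _ (hA₀.snd_le 0) (hA₀.snd_le 2),
      hY ▸ hcast _ _ (hA₀.snd_le 1) (hA₀.snd_le 3)]
  · intro x hx i
    obtain ⟨h1, h2, h3, h4⟩ := hS x hx
    fin_cases i
    exacts [⟨x.1 2, h1.symm⟩, ⟨x.1 3, h2.symm⟩, ⟨x.2 2, h3.symm⟩, ⟨x.2 3, h4.symm⟩]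
  · intro x hx y hy h
    obtain ⟨h1, h2, h3, h4⟩ := hS x hx
    obtain ⟨k1, k2, k3, k4⟩ := hS y hy
    have hny := hne y hy
    have e1 : x.1 0 = y.1 0 := congrFun h 0
    have e2 : x.1 1 = y.1 1 := congrFun h 1
    have e3 : x.2 0 = y.2 0 := congrFun h 2
    have e4 : x.2 1 = y.2 1 := congrFun h 3
    rw [e1] at h1
    rw [e2] at h2
    rw [e3] at h3
    rw [e4] at h4
    exact tuple_ext e1 e2 (mul_left_cancel₀ (hny 0).1 (h1.trans k1.symm))
      (mul_left_cancel₀ (hny 1).1 (h2.trans k2.symm)) e3 e4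
      (mul_left_cancel₀ (hny 0).2 (h3.trans k3.symm))
      (mul_left_cancel₀ (hny 1).2 (h4.trans k4.symm))

theorem Δ₀_eq_cross (x : (Fin 4 → ℤ) × (Fin 4 → ℤ)) :
    Δ₀ x = x.1 0 * x.1 2 * (x.1 1 * x.1 3 - x.2 1 * x.2 3) +
      (x.1 0 * x.1 2 - x.2 0 * x.2 2) * (x.2 1 * x.2 3) := by
  unfold Δ₀; ring

include hM in
theorem rpow_two_sub_le (hκ : 0 ≤ κ) : M ^ (2 - κ) ≤ M ^ 2 := by
  rw [← Real.rpow_natCast]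
  exact Real.rpow_le_rpow_of_exponent_le hM (by push_cast; linarith)

include hM hT hΛ in
theorem weightBound_of_cross_small_of_ne (hκ0 : 0 ≤ κ) (hκ : κ ≤ 1) :
    WeightBound M T ε δ (fun x => (Δ₀ x ≠ 0 ∧ (∀ i, x.1 i ≠ 0 ∧ x.2 i ≠ 0) ∧
      |((x.1 0 * x.1 2 - x.2 0 * x.2 2 : ℤ) : ℝ)| ≤ 2 * M ^ (2 - κ)) ∧
      (x.1 0 * x.1 2 - x.2 0 * x.2 2) * (x.2 1 * x.2 3) ≠ Δ₀ x)
      (familyBound M T ε κ Λ) := by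
  intro S hS
  have hM0 : 0 < M := by linarith
  have hT0 : 0 < T := by linarith
  have hM2 := rpow_two_sub_le hM hκ0
  have hΛ0 : 0 ≤ Λ := zero_le_one.trans hΛ.one_le
  refine (sum_le_of_fibers hΛ S (weight T) (fun x => ![Δ₀ x])
    (fun x => ![x.1 0 * x.1 2 - x.2 0 * x.2 2, x.2 1 * x.2 3])
    ![2 * M ^ (2 - κ), M ^ 2] (K := (T ^ 2)⁻¹) (F := Λ * Λ ^ 4) (by positivity) ?_ ?_ ?_ ?_
    (by positivity) ?_).trans ?_
  · intro i
    fin_cases i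
    · have : 1 ≤ M ^ (2 - κ) := Real.one_le_rpow hM (by linarith)
      change 1 ≤ 2 * M ^ (2 - κ)
      linarith
    · exact one_le_pow₀ hM
  · intro x hx i
    have h := (hS x hx).1
    fin_cases i
    exact abs_le_of_abs_le_two_mul_pow h.abs_Δ₀_le
  · intro x hx i
    have h := (hS x hx).1
    fin_cases i
    · exact (hS x hx).2.1.2.2
    · change |((x.2 1 * x.2 3 : ℤ) : ℝ)| ≤ M ^ 2
      push_cast
      nlinarith [abs_mul_le_mul (h.snd_le 1) (h.snd_le 3)]
  · intro x hx
    obtain ⟨h, ⟨h0, -⟩, -⟩ := hS x hx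
    simpa using h.weight_le_of_ne_zero hT h0
  · intro x₀ h₀ S' hS' hc
    obtain ⟨hA, ⟨h0, hne, he⟩, hd⟩ := hS x₀ h₀
    set e := x₀.1 0 * x₀.1 2 - x₀.2 0 * x₀.2 2
    set Y := x₀.2 1 * x₀.2 3
    have hn : Δ₀ x₀ - e * Y ≠ 0 := fun h => hd (by linarith)
    have hfac : ∀ x ∈ S', x.1 0 * x.1 2 * (x.1 1 * x.1 3 - x.2 1 * x.2 3) = Δ₀ x₀ - e * Y := by
      intro x hx
      obtain ⟨h1, h2⟩ := hc x hx
      have k0 : Δ₀ x = Δ₀ x₀ := congrFun h1 0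
      have k1 : x.1 0 * x.1 2 - x.2 0 * x.2 2 = e := congrFun h2 0
      have k2 : x.2 1 * x.2 3 = Y := congrFun h2 1
      rw [← k0, ← k1, ← k2, Δ₀_eq_cross]; ring
    have hnM : |((Δ₀ x₀ - e * Y : ℤ) : ℝ)| ≤ 8 * M ^ 4 := by
      have hY : |(Y : ℝ)| ≤ M ^ 2 := by
        push_cast [Y]
        nlinarith [abs_mul_le_mul (hA.snd_le 1) (hA.snd_le 3)]
      have h1 := abs_mul_le_mul he hY
      have h2 := abs_sub (Δ₀ x₀ : ℝ) (e * Y : ℝ)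
      have h3 := hA.abs_Δ₀_le
      have h4 : 2 * M ^ (2 - κ) * M ^ 2 ≤ 2 * M ^ 2 * M ^ 2 := by gcongr
      push_cast
      nlinarith [show 0 ≤ M ^ 4 by positivity]
    refine card_le_mul_of_dvd hΛ S' (fun x => x.1 0 * x.1 2) hn hnM
      (fun x hx => ⟨_, (hfac x hx).symm⟩) (by positivity) fun c hcn => ?_
    obtain ⟨W, hW⟩ := hcn
    have hc0 : c ≠ 0 := left_ne_zero_of_mul (hW ▸ hn)
    have hsub : ∀ x ∈ S'.filter (fun x => x.1 0 * x.1 2 = c), x ∈ S' := fun x hx =>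
      (Finset.mem_filter.mp hx).1
    refine card_le_of_cross_prod_eq hM hΛ (u := c) (v := c - e) (X := W + Y) (Y := Y)
      (fun x hx => (hS x (hS' (hsub x hx))).1)
      (fun x hx => (hS x (hS' (hsub x hx))).2.1.2.1) fun x hx => ?_
    obtain ⟨hx', hu⟩ := Finset.mem_filter.mp hx
    have k1 : x.1 0 * x.1 2 - x.2 0 * x.2 2 = e := congrFun (hc x hx').2 0
    have k2 : x.2 1 * x.2 3 = Y := congrFun (hc x hx').2 1
    have hf := hfac x hx'
    rw [hu, hW] at hf
    have hX := mul_left_cancel₀ hc0 hf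
    exact ⟨hu, by linarith, by linarith, k2⟩
  · refine le_familyBound_trd hM hT (c := 18) (k := 6) (by norm_num) (by norm_num) hΛ.one_le ?_
    have e : M ^ (4 - κ) = M ^ 2 * M ^ (2 - κ) := by
      rw [← Real.rpow_natCast, ← Real.rpow_add hM0]
      congr 1; push_cast; ring
    rw [e]
    simp only [Fin.prod_univ_two]
    change (T ^ 2)⁻¹ * (Λ * Λ ^ 4) * Λ ^ 1 * (3 * (2 * M ^ (2 - κ)) * (3 * M ^ 2)) ≤ _
    refine le_of_eq ?_
    field_simp
    ring

include hM hT hΛ in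
theorem weightBound_of_cross_small_of_eq (hε : 0 < ε) :
    WeightBound M T ε δ (fun x => (Δ₀ x ≠ 0 ∧ ∀ i, x.1 i ≠ 0 ∧ x.2 i ≠ 0) ∧
      (x.1 0 * x.1 2 - x.2 0 * x.2 2) * (x.2 1 * x.2 3) = Δ₀ x)
      (familyBound M T ε κ Λ) := by
  intro S hS
  have hM0 : 0 < M := by linarith
  have hT0 : 0 < T := by linarith
  have hΛ0 : 0 ≤ Λ := zero_le_one.trans hΛ.one_le
  refine (sum_le_of_fibers hΛ S (weight T) (fun x => ![Δ₀ x]) (fun x => ![x.1 0 * x.1 2])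
    (fun _ => M ^ 2) (K := (T ^ 2)⁻¹) (F := Λ * Λ ^ 4) (by positivity)
    (fun _ => one_le_pow₀ hM) ?_ ?_ ?_ (by positivity) ?_).trans ?_
  · intro x hx i
    have h := (hS x hx).1
    fin_cases i
    exact abs_le_of_abs_le_two_mul_pow h.abs_Δ₀_le
  · intro x hx i
    have h := (hS x hx).1
    fin_cases i
    change |((x.1 0 * x.1 2 : ℤ) : ℝ)| ≤ M ^ 2
    push_cast
    nlinarith [abs_mul_le_mul (h.fst_le 0) (h.fst_le 2)]
  · intro x hx
    obtain ⟨h, ⟨h0, -⟩, -⟩ := hS x hx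
    simpa using h.weight_le_of_ne_zero hT h0
  · intro x₀ h₀ S' hS' hc
    obtain ⟨hA, ⟨h0, hne⟩, hd⟩ := hS x₀ h₀
    have hΔ : ∀ x ∈ S', Δ₀ x = Δ₀ x₀ := fun x hx => congrFun (hc x hx).1 0
    refine card_le_mul_of_dvd hΛ S' (fun x => x.1 0 * x.1 2 - x.2 0 * x.2 2) h0
      (abs_le_of_abs_le_two_mul_pow hA.abs_Δ₀_le)
      (fun x hx => ⟨_, ((hS x (hS' hx)).2.2.trans (hΔ x hx)).symm⟩) (by positivity)
      fun c hcn => ?_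
    obtain ⟨Y, hY⟩ := hcn
    have hc0 : c ≠ 0 := left_ne_zero_of_mul (hY ▸ h0)
    have hsub : ∀ x ∈ S'.filter (fun x => x.1 0 * x.1 2 - x.2 0 * x.2 2 = c), x ∈ S' :=
      fun x hx => (Finset.mem_filter.mp hx).1
    refine card_le_of_cross_prod_eq hM hΛ (u := x₀.1 0 * x₀.1 2) (v := x₀.1 0 * x₀.1 2 - c)
      (X := Y) (Y := Y) (fun x hx => (hS x (hS' (hsub x hx))).1)
      (fun x hx => (hS x (hS' (hsub x hx))).2.1.2) fun x hx => ?_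
    obtain ⟨hx', he⟩ := Finset.mem_filter.mp hx
    have hu : x.1 0 * x.1 2 = x₀.1 0 * x₀.1 2 := congrFun (hc x hx').2 0
    have hx2 := (hS x (hS' hx')).2
    have hcY := hx2.2
    rw [he, hΔ x hx', hY] at hcY
    have hY' := mul_left_cancel₀ hc0 hcY
    have hcr := Δ₀_eq_cross x
    rw [hx2.2] at hcr
    have hu0 : x.1 0 * x.1 2 ≠ 0 := mul_ne_zero (hx2.1.2 0).1 (hx2.1.2 2).1
    have hW := (mul_eq_zero.mp (by linarith :
      x.1 0 * x.1 2 * (x.1 1 * x.1 3 - x.2 1 * x.2 3) = 0)).resolve_left hu0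
    exact ⟨hu, by linarith, by linarith, hY'⟩
  · refine le_familyBound_fst hM hT (c := 3) (j := 2) (k := 6) (by norm_num) (by norm_num)
      (by norm_num) hΛ.one_le ?_
    have h1 : 1 ≤ M ^ ε := Real.one_le_rpow hM hε.le
    calc _ = 3 * Λ ^ 6 * (1 * M ^ 2 / T ^ 2) := by
          simp only [Fin.prod_univ_one]
          field_simp
          exact (pow_add Λ 5 1).symm
      _ ≤ _ := by gcongr

include hM hT hΛ in
theorem weightBound_of_cross_small (hε : 0 < ε) (hκ0 : 0 ≤ κ) (hκ : κ ≤ 1) :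
    WeightBound M T ε δ (fun x => Δ₀ x ≠ 0 ∧ (∀ i, x.1 i ≠ 0 ∧ x.2 i ≠ 0) ∧
      |((x.1 0 * x.1 2 - x.2 0 * x.2 2 : ℤ) : ℝ)| ≤ 2 * M ^ (2 - κ))
      (2 * familyBound M T ε κ Λ) := by
  refine ((weightBound_of_cross_small_of_ne hM hT hΛ hκ0 hκ).of_cases
    (weightBound_of_cross_small_of_eq hM hT hΛ hε) fun x _ hp => ?_).mono (two_mul _).ge
  by_cases h : (x.1 0 * x.1 2 - x.2 0 * x.2 2) * (x.2 1 * x.2 3) = Δ₀ x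
  exacts [Or.inr ⟨⟨hp.1, hp.2.1⟩, h⟩, Or.inl ⟨hp, h⟩]

theorem WeightBound.of_exists {M T ε δ b : ℝ} {ι : Type*} [Fintype ι]
    {q : ι → (Fin 4 → ℤ) × (Fin 4 → ℤ) → Prop} (h : ∀ i, WeightBound M T ε δ (q i) b) :
    WeightBound M T ε δ (fun x => ∃ i, q i x) (Fintype.card ι * b) := by
  intro S hS
  rcases isEmpty_or_nonempty ι with hι | hι
  · have : S = ∅ := Finset.eq_empty_of_forall_notMem fun x hx => by
      obtain ⟨i, -⟩ := (hS x hx).2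
      exact hι.elim i
    simp [this]
  · have hex : ∀ x, ∃ i, x ∈ S → q i x := fun x => by
      by_cases hx : x ∈ S
      · obtain ⟨i, hi⟩ := (hS x hx).2
        exact ⟨i, fun _ => hi⟩
      · exact ⟨Classical.arbitrary ι, fun h => absurd h hx⟩
    choose f hf using hex
    rw [← Finset.sum_fiberwise S f]
    refine (Finset.sum_le_card_nsmul Finset.univ _ b fun i _ => h i _ fun x hx => ?_).trans_eq ?_
    · obtain ⟨hxS, rfl⟩ := Finset.mem_filter.mp hx
      exact ⟨(hS x hxS).1, hf x hxS⟩
    · rw [nsmul_eq_mul, Finset.card_univ]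

include hM hT hΛ in
theorem familyBound_nonneg : 0 ≤ familyBound M T ε κ Λ := by
  have hΛ0 : 0 ≤ Λ := zero_le_one.trans hΛ.one_le
  unfold familyBound
  positivity

include hM hT hΛ in
theorem weightBound_of_exists_zero_pair :
    WeightBound M T ε δ (fun x => ∃ i : Fin 4 × Fin 4, x.1 i.1 = 0 ∧ x.2 i.2 = 0)
      (64 * familyBound M T ε κ Λ) := by
  have hF : 0 ≤ familyBound M T ε κ Λ := familyBound_nonneg hM hT hΛ
  have h1 : WeightBound M T ε δ (fun x => x.1 0 = 0 ∧ x.2 1 = 0) (4 * familyBound M T ε κ Λ) :=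
    (weightBound_of_zero_same_half hM hT hΛ).mono (by linarith)
  have h2 : WeightBound M T ε δ (fun x => x.1 0 = 0 ∧ x.2 2 = 0) (4 * familyBound M T ε κ Λ) :=
    weightBound_of_zero_diff_half hM hT hΛ
  have hd : ∀ i, WeightBound M T ε δ (fun x => x.1 i = 0 ∧ x.2 i = 0)
      (4 * familyBound M T ε κ Λ) := fun i =>
    h1.of_forall_imp fun x hx hp => ((hx.ne i).elim (· hp.1) (· hp.2)).elim
  refine (WeightBound.of_exists (b := 4 * familyBound M T ε κ Λ) fun i => ?_).mono (le_of_eq ?_)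
  · obtain ⟨i, j⟩ := i
    fin_cases i <;> fin_cases j
    exacts [hd 0, h1, h2, h2.swapRight, h1.swapLeft, hd 1, h2.swapLeft, h2.swapLeft.swapRight,
      h2.swapHalves, h2.swapRight.swapHalves, hd 2, h1.swapHalves, h2.swapLeft.swapHalves,
      h2.swapLeft.swapRight.swapHalves, h1.swapLeft.swapHalves, hd 3]
  · simp only [Fintype.card_prod, Fintype.card_fin]
    push_cast
    ring

include hM hT hΛ in
theorem weightBound_of_Δ₀_ne_zero_of_exists_eq_zero (hε : 0 < ε) :
    WeightBound M T ε δ (fun x => ∃ i, Δ₀ x ≠ 0 ∧ x.1 i = 0) (4 * familyBound M T ε κ Λ) := by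
  have h : WeightBound M T ε δ (fun x => Δ₀ x ≠ 0 ∧ x.1 0 = 0) (familyBound M T ε κ Λ) :=
    weightBound_of_Δ₀_ne_zero_of_eq_zero hM hT hΛ hε
  refine (WeightBound.of_exists (b := familyBound M T ε κ Λ) fun i => ?_).mono (le_of_eq ?_)
  · fin_cases i
    · exact h
    · exact h.swapLeft.of_forall_imp fun x _ hx => ⟨(Δ₀_swapLeft x).trans_ne hx.1, hx.2⟩
    · exact h.swapHalves.of_forall_imp fun x _ hx => ⟨(Δ₀_swapHalves x).trans_ne hx.1, hx.2⟩
    · exact h.swapLeft.swapHalves.of_forall_imp fun x _ hx =>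
        ⟨((Δ₀_swapLeft _).trans (Δ₀_swapHalves x)).trans_ne hx.1, hx.2⟩
  · rw [Fintype.card_fin]; norm_num

theorem fst_one_mul_cross_mul_cross (x : (Fin 4 → ℤ) × (Fin 4 → ℤ)) :
    x.1 1 * (x.1 0 * x.1 2 - x.2 0 * x.2 2) * (x.1 0 * x.1 3 - x.2 0 * x.2 3) =
      x.1 0 * Δ₀ x - x.2 0 * Δ₁ x := by
  unfold Δ₀ Δ₁
  ring

include hM hT in
theorem Admissible.cross_small_or {x : (Fin 4 → ℤ) × (Fin 4 → ℤ)} (h : Admissible M T ε δ x)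
    (hε : 0 < ε) (hδ : δ ≤ 2) (hκ : 3 * κ + ε ≤ δ) (ha : M ^ (1 - κ) < |(x.1 1 : ℝ)|) :
    |((x.1 0 * x.1 2 - x.2 0 * x.2 2 : ℤ) : ℝ)| ≤ 2 * M ^ (2 - κ) ∨
      |((x.1 0 * x.1 3 - x.2 0 * x.2 3 : ℤ) : ℝ)| ≤ 2 * M ^ (2 - κ) := by
  have hM0 : 0 < M := by linarith
  by_contra! hc
  obtain ⟨h2, h3⟩ := hc
  have hP : (Pmax x : ℝ) / T ≤ M ^ (4 - δ) := by
    have hP0 : (0 : ℝ) ≤ Pmax x := by exact_mod_cast h.pos.le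
    refine (div_le_self hP0 hT).trans (h.Pmax_le.trans ?_)
    rw [← Real.rpow_natCast]
    exact Real.rpow_le_rpow_of_exponent_le hM (by push_cast; linarith)
  have hε1 : 1 ≤ M ^ ε := Real.one_le_rpow hM hε.le
  have hD : 0 < M ^ (4 - δ) := by positivity
  have h₁ : |(Δ₁ x : ℝ)| ≤ M ^ ε * (2 * M ^ (4 - δ)) := by
    refine h.le₁.trans ?_
    have := h.le₀
    gcongr
    linarith
  have hid : |(x.1 1 : ℝ)| * |((x.1 0 * x.1 2 - x.2 0 * x.2 2 : ℤ) : ℝ)| *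
      |((x.1 0 * x.1 3 - x.2 0 * x.2 3 : ℤ) : ℝ)| = |(x.1 0 * Δ₀ x - x.2 0 * Δ₁ x : ℝ)| := by
    rw [← abs_mul, ← abs_mul]
    congr 1
    exact_mod_cast fst_one_mul_cross_mul_cross x
  have hup : |(x.1 0 * Δ₀ x - x.2 0 * Δ₁ x : ℝ)| ≤ 3 * (M * M ^ ε * M ^ (4 - δ)) := by
    have e1 := abs_mul_le_mul (h.fst_le 0) h.le₀
    have e2 := abs_mul_le_mul (h.snd_le 0) h₁
    have e3 := abs_sub (x.1 0 * Δ₀ x : ℝ) (x.2 0 * Δ₁ x)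
    have e4 : M * M ^ (4 - δ) ≤ M * M ^ ε * M ^ (4 - δ) := by
      gcongr
      exact le_mul_of_one_le_right hM0.le hε1
    linarith
  have hlow : M ^ (1 - κ) * (2 * M ^ (2 - κ)) * (2 * M ^ (2 - κ)) ≤
      |(x.1 1 : ℝ)| * |((x.1 0 * x.1 2 - x.2 0 * x.2 2 : ℤ) : ℝ)| *
      |((x.1 0 * x.1 3 - x.2 0 * x.2 3 : ℤ) : ℝ)| := by
    gcongr
  have hpow : M * M ^ ε * M ^ (4 - δ) ≤ M ^ (1 - κ) * M ^ (2 - κ) * M ^ (2 - κ) := by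
    nth_rewrite 1 [← Real.rpow_one M]
    simp only [← Real.rpow_add hM0]
    exact Real.rpow_le_rpow_of_exponent_le hM (by linarith)
  have hpos : 0 < M * M ^ ε * M ^ (4 - δ) := by positivity
  linarith

include hM hT hΛ in
theorem weightBound_of_forall_ne_zero (hε : 0 < ε) (hδ : δ ≤ 2) (hκ0 : 0 ≤ κ) (hκ1 : κ ≤ 1)
    (hκ : κ = 0 ∨ 3 * κ + ε ≤ δ) :
    WeightBound M T ε δ (fun x => Δ₀ x ≠ 0 ∧ ∀ i, x.1 i ≠ 0 ∧ x.2 i ≠ 0)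
      (5 * familyBound M T ε κ Λ) := by
  have hc : WeightBound M T ε δ _ (2 * familyBound M T ε κ Λ) :=
    weightBound_of_cross_small hM hT hΛ hε hκ0 hκ1
  have hs : WeightBound M T ε δ _ (familyBound M T ε κ Λ) :=
    weightBound_of_Δ₀_ne_zero_of_small hM hT hΛ hκ1
  refine (hs.of_cases (hc.of_cases hc.swapRight (p := fun x =>
    (Δ₀ x ≠ 0 ∧ ∀ i, x.1 i ≠ 0 ∧ x.2 i ≠ 0) ∧ M ^ (1 - κ) < |(x.1 1 : ℝ)|) ?_) ?_).mono ?_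
  · rintro x hx ⟨⟨h0, hne⟩, ha⟩
    have hκ' : 3 * κ + ε ≤ δ := hκ.resolve_left fun h => by
      rw [h, sub_zero, Real.rpow_one] at ha
      exact ha.not_ge (hx.fst_le 1)
    refine (hx.cross_small_or hM hT hε hδ hκ' ha).imp (fun h => ⟨h0, hne, h⟩) fun h =>
      ⟨(Δ₀_swapRight x).trans_ne h0, fun i => ?_, h⟩
    fin_cases i
    exacts [hne 0, hne 1, hne 3, hne 2]
  · rintro x - ⟨h0, hne⟩
    rcases le_or_gt |(x.1 1 : ℝ)| (M ^ (1 - κ)) with h | h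
    exacts [Or.inl ⟨h0, fun i => (hne i).2, h⟩, Or.inr ⟨⟨h0, hne⟩, h⟩]
  · linarith

include hM hT hΛ in
theorem weightBound_true (hε : 0 < ε) (hδ : δ ≤ 2) (hκ0 : 0 ≤ κ) (hκ1 : κ ≤ 1)
    (hκ : κ = 0 ∨ 3 * κ + ε ≤ δ) :
    WeightBound M T ε δ (fun _ => True) (78 * familyBound M T ε κ Λ) := by
  have h1 : WeightBound M T ε δ _ (familyBound M T ε κ Λ) := weightBound_of_Δ₀_eq_zero hM hT hΛ
  have h2 : WeightBound M T ε δ _ (64 * familyBound M T ε κ Λ) :=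
    weightBound_of_exists_zero_pair hM hT hΛ
  have h3 : WeightBound M T ε δ _ (4 * familyBound M T ε κ Λ) :=
    weightBound_of_Δ₀_ne_zero_of_exists_eq_zero hM hT hΛ hε
  have h4 : WeightBound M T ε δ _ (5 * familyBound M T ε κ Λ) :=
    weightBound_of_forall_ne_zero hM hT hΛ hε hδ hκ0 hκ1 hκ
  refine ((h1.of_cases h2 (p := fun x => Δ₀ x = 0) ?_).of_cases
    ((h3.of_cases h3.swap (p := fun x => Δ₀ x ≠ 0 ∧ ∃ i, x.1 i = 0 ∨ x.2 i = 0) ?_).of_cases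
      h4 (p := fun x => Δ₀ x ≠ 0) ?_) ?_).mono ?_
  · intro x _ h0
    by_cases ha : ∀ i, x.1 i ≠ 0
    · exact Or.inl ⟨h0, ha⟩
    push Not at ha
    obtain ⟨i, hi⟩ := ha
    have hprod : ∏ i, x.1 i = ∏ i, x.2 i := by
      simp only [Fin.prod_univ_four]
      exact sub_eq_zero.mp h0
    rw [Finset.prod_eq_zero (Finset.mem_univ i) hi] at hprod
    obtain ⟨j, -, hj⟩ := Finset.prod_eq_zero_iff.mp hprod.symm
    exact Or.inr ⟨(i, j), hi, hj⟩
  · rintro x - ⟨h0, i, h | h⟩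
    · exact Or.inl ⟨i, h0, h⟩
    · exact Or.inr ⟨i, (Δ₀_swap x).trans_ne (neg_ne_zero.mpr h0), h⟩
  · intro x _ h0
    by_cases h : ∃ i, x.1 i = 0 ∨ x.2 i = 0
    · exact Or.inl ⟨h0, h⟩
    · push Not at h
      exact Or.inr ⟨h0, h⟩
  · exact fun x _ _ => em _
  · linarith

end families

theorem familyBound_le {M T ε δ κ ν C : ℝ} (hM : 1 ≤ M) (hT : 1 ≤ T)
    (h₁ : 24 * ν + 3 ≤ 4 - δ / 5) (h₂ : 24 * ν ≤ ε) (h₃ : 24 * ν ≤ ε + κ - δ / 5) :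
    familyBound M T ε κ (C * (8 * M ^ 4) ^ ν) ≤
      200 * (C * 8 ^ ν) ^ 6 * M ^ ε * (M ^ (4 - δ / 5) / T ^ 2 + M ^ 2 / T) := by
  have hM0 : 0 < M := by linarith
  have hT0 : 0 < T := by linarith
  have hΛ : (C * (8 * M ^ 4) ^ ν) ^ 6 = (C * 8 ^ ν) ^ 6 * M ^ (24 * ν) := by
    rw [Real.mul_rpow (by norm_num) (by positivity), ← mul_assoc, mul_pow _ ((M ^ 4) ^ ν),
      ← Real.rpow_natCast M 4, ← Real.rpow_mul hM0.le, ← Real.rpow_natCast _ 6,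
      ← Real.rpow_natCast (M ^ _) 6, ← Real.rpow_mul hM0.le]
    congr 2
    push_cast
    ring
  have e₁ : M ^ (24 * ν) * M ^ 3 ≤ M ^ (4 - δ / 5) := by
    rw [← Real.rpow_natCast, ← Real.rpow_add hM0]
    exact Real.rpow_le_rpow_of_exponent_le hM (by push_cast; linarith)
  have e₂ : M ^ (24 * ν) ≤ M ^ ε := Real.rpow_le_rpow_of_exponent_le hM h₂
  have e₃ : M ^ (24 * ν) * M ^ (4 - κ) ≤ M ^ ε * M ^ (4 - δ / 5) := by
    rw [← Real.rpow_add hM0, ← Real.rpow_add hM0]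
    exact Real.rpow_le_rpow_of_exponent_le hM (by linarith)
  calc familyBound M T ε κ (C * (8 * M ^ 4) ^ ν)
      = 100 * (C * 8 ^ ν) ^ 6 * (M ^ ε * ((M ^ (24 * ν) * M ^ 3) / T ^ 2) +
        M ^ (24 * ν) * (M ^ 2 / T) + (M ^ (24 * ν) * M ^ (4 - κ)) / T ^ 2) := by
        rw [familyBound, hΛ]; ring
    _ ≤ 100 * (C * 8 ^ ν) ^ 6 * (M ^ ε * (M ^ (4 - δ / 5) / T ^ 2) +
        M ^ ε * (M ^ 2 / T) + (M ^ ε * M ^ (4 - δ / 5)) / T ^ 2) := by gcongr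
    _ = 200 * (C * 8 ^ ν) ^ 6 * M ^ ε * (M ^ (4 - δ / 5) / T ^ 2 + M ^ 2 / T) -
        100 * (C * 8 ^ ν) ^ 6 * (M ^ ε * (M ^ 2 / T)) := by ring
    _ ≤ _ := sub_le_self _ (by positivity)

/-- **Estimate (2.14).** For `M^η ≤ T ≤ M^{2-η}`, the sum of `1/(T²(|Δ| + P/T))` over all
integer 8-tuples `(a,b)` with all four pairs `(aᵢ, bᵢ) ≠ (0,0)`, `|aᵢ|, |bᵢ| ≤ M`, `P ≠ 0`,
`|Δ| ≤ M^{4-δ}` and `|Δ₁|, |Δ₂| ≤ M^ε(|Δ| + P/T)` is `≪ M^ε (M^{4-δ/5}/T² + M²/T)`. -/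
theorem count_small_determinants (η δ ε : ℝ) (hη : 0 < η) (hδ0 : 0 < δ) (hδ : δ < 1 / 2)
    (hε : 0 < ε) :
    ∃ C : ℝ, 0 < C ∧ ∀ M T : ℝ, 1 ≤ M → 1 ≤ T → M ^ η ≤ T → T ≤ M ^ (2 - η) →
      (∑' x : (Fin 4 → ℤ) × (Fin 4 → ℤ),
        if (x.1 0, x.2 0) ≠ ((0 : ℤ), (0 : ℤ)) ∧ (x.1 1, x.2 1) ≠ ((0 : ℤ), (0 : ℤ)) ∧
            (x.1 2, x.2 2) ≠ ((0 : ℤ), (0 : ℤ)) ∧ (x.1 3, x.2 3) ≠ ((0 : ℤ), (0 : ℤ)) ∧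
            (∀ i, |(x.1 i : ℝ)| ≤ M ∧ |(x.2 i : ℝ)| ≤ M) ∧
            Pmax x ≠ 0 ∧ |(Δ₀ x : ℝ)| ≤ M ^ (4 - δ) ∧
            |(Δ₁ x : ℝ)| ≤ M ^ ε * (|(Δ₀ x : ℝ)| + (Pmax x : ℝ) / T) ∧
            |(Δ₂ x : ℝ)| ≤ M ^ ε * (|(Δ₀ x : ℝ)| + (Pmax x : ℝ) / T)
        then (T ^ 2 * (|(Δ₀ x : ℝ)| + (Pmax x : ℝ) / T))⁻¹ else 0)
      ≤ C * M ^ ε * (M ^ (4 - δ / 5) / T ^ 2 + M ^ 2 / T) := by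

  obtain ⟨κ, hκ0, hκ1, hκ, hκε⟩ : ∃ κ : ℝ, 0 ≤ κ ∧ κ ≤ 1 ∧ (κ = 0 ∨ 3 * κ + ε ≤ δ) ∧
      0 < ε + κ - δ / 5 := by
    rcases lt_or_ge ε (δ / 4) with h | h
    · exact ⟨δ / 5, by linarith, by linarith, Or.inr (by linarith), by linarith⟩
    · exact ⟨0, le_rfl, zero_le_one, Or.inl rfl, by linarith⟩
  obtain ⟨ν, hν, hν₁, hν₂, hν₃⟩ : ∃ ν : ℝ, 0 < ν ∧ 24 * ν + 3 ≤ 4 - δ / 5 ∧ 24 * ν ≤ ε ∧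
      24 * ν ≤ ε + κ - δ / 5 := by
    refine ⟨min (1 / 2) (min ε (ε + κ - δ / 5)) / 24, by positivity, ?_⟩
    have h₁ := min_le_left (1 / 2) (min ε (ε + κ - δ / 5))
    have h₂ := min_le_right (1 / 2) (min ε (ε + κ - δ / 5))
    have h₃ := min_le_left ε (ε + κ - δ / 5)
    have h₄ := min_le_right ε (ε + κ - δ / 5)
    exact ⟨by linarith, by linarith, by linarith⟩
  obtain ⟨C, hC, hΛ⟩ := exists_divisorHarmonicBound ν hν
  refine ⟨78 * (200 * (C * 8 ^ ν) ^ 6), by positivity, fun M T hM hT _ _ => ?_⟩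
  have hM0 : 0 < M := by linarith
  have hT0 : 0 < T := by linarith
  have hbound : WeightBound M T ε δ (fun _ => True) (78 * (200 * (C * 8 ^ ν) ^ 6) * M ^ ε *
      (M ^ (4 - δ / 5) / T ^ 2 + M ^ 2 / T)) := by
    refine (weightBound_true hM hT (hΛ (8 * M ^ 4) ?_) hε (by linarith) hκ0 hκ1 hκ).mono ?_
    · linarith [one_le_pow₀ hM (n := 4)]
    · linarith [familyBound_le hM hT (C := C) hν₁ hν₂ hν₃]
  refine tsum_le_of_sum_le' (by positivity) fun S => ?_
  rw [← Finset.sum_filter]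
  refine hbound _ fun x hx => ⟨?_, trivial⟩
  obtain ⟨h₀, h₁, h₂, h₃, hle, hP, hd₀, hd₁, hd₂⟩ := (Finset.mem_filter.mp hx).2
  have hP0 : 0 ≤ Pmax x := (abs_nonneg _).trans (Admissible.abs_mul_le_Pmax x).1
  refine ⟨fun i => ?_, fun i => (hle i).1, fun i => (hle i).2, hP0.lt_of_ne' hP, hd₀, hd₁, hd₂⟩
  rw [← not_and_or, ← Prod.mk_inj]
  fin_cases i <;> assumption
end

section
/- For every ε > 0, M ≥ 2 and P ≥ 1, the number of 8-tuples (a₁,…,a₄,b₁,…,b₄) of nonzero integers with |aᵢ|, |bᵢ| ≤ M for all i, a₁a₂a₃a₄ = b₁b₂b₃b₄, and max(|a₁a₂|, |a₃a₄|, |b₁b₂|, |b₃b₄|) ≤ P, is ≪_ε P·M^{2+ε}. -/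
/-- The divisor bound `τ(n) ≪_δ n ^ δ`. -/
theorem Nat.exists_card_divisors_le_rpow (δ : ℝ) (hδ : 0 < δ) :
    ∃ C : ℝ, 0 < C ∧ ∀ n : ℕ, (n.divisors.card : ℝ) ≤ C * (n : ℝ) ^ δ := by
  set B : ℕ := ⌈(2 : ℝ) ^ (1 / δ)⌉₊ with hB
  have hlog : 0 < Real.log 2 := Real.log_pos one_lt_two
  set K : ℝ := 1 + 1 / (δ * Real.log 2) with hK
  have hK1 : 1 ≤ K := by rw [hK]; linarith [show 0 < 1 / (δ * Real.log 2) by positivity]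
  have small (p a : ℕ) (hp : 2 ≤ p) : (a + 1 : ℝ) ≤ K * ((p : ℝ) ^ a) ^ δ := by
    have hp' : (2 : ℝ) ≤ p := mod_cast hp
    have h : 1 + a * (δ * Real.log 2) ≤ ((p : ℝ) ^ a) ^ δ := by
      calc 1 + a * (δ * Real.log 2) ≤ Real.exp (a * (δ * Real.log 2)) := by
            linarith [Real.add_one_le_exp (a * (δ * Real.log 2))]
        _ = ((2 : ℝ) ^ a) ^ δ := by
            rw [Real.rpow_def_of_pos (by positivity), Real.log_pow]
            ring_nf
        _ ≤ _ := by gcongr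
    have hc : 0 < δ * Real.log 2 := by positivity
    calc (a + 1 : ℝ) ≤ K * (1 + a * (δ * Real.log 2)) := by
          have : K * (1 + a * (δ * Real.log 2))
              = 1 + 1 / (δ * Real.log 2) + a * (δ * Real.log 2) + a := by
            rw [hK]; field_simp; ring
          rw [this]
          have : 0 < 1 / (δ * Real.log 2) := by positivity
          have : 0 ≤ a * (δ * Real.log 2) := by positivity
          linarith
      _ ≤ _ := by gcongr
  have large (p a : ℕ) (hp : B ≤ p) : (a + 1 : ℝ) ≤ ((p : ℝ) ^ a) ^ δ := by
    have hp' : (2 : ℝ) ^ (1 / δ) ≤ p := (Nat.le_ceil _).trans (mod_cast hp)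
    calc (a + 1 : ℝ) ≤ 2 ^ a := mod_cast Nat.lt_two_pow_self
      _ = (((2 : ℝ) ^ (1 / δ)) ^ a) ^ δ := by
          rw [← Real.rpow_natCast, ← Real.rpow_natCast, ← Real.rpow_mul (by positivity),
            ← Real.rpow_mul (by positivity)]
          congr 1
          field_simp
      _ ≤ _ := by gcongr
  refine ⟨K ^ B, by positivity, fun n ↦ ?_⟩
  rcases eq_or_ne n 0 with rfl | hn
  · simp [Real.zero_rpow hδ.ne']
  have hfact : (n : ℝ) ^ δ = ∏ p ∈ n.primeFactors, ((p : ℝ) ^ n.factorization p) ^ δ := by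
    rw [Real.finsetProd_rpow _ _ (fun _ _ ↦ by positivity)]
    congr 1
    conv_lhs => rw [← Nat.prod_factorization_pow_eq_self hn]
    simp [Finsupp.prod]
  rw [Nat.card_divisors hn, hfact]
  push_cast
  calc ∏ p ∈ n.primeFactors, ((n.factorization p : ℝ) + 1)
      ≤ ∏ p ∈ n.primeFactors, (if p < B then K else 1) * ((p : ℝ) ^ n.factorization p) ^ δ := by
        refine Finset.prod_le_prod (fun _ _ ↦ by positivity) fun p hp ↦ ?_
        split_ifs with h
        · exact small p _ (Nat.prime_of_mem_primeFactors hp).two_le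
        · rw [one_mul]; exact large p _ (not_lt.1 h)
    _ = (∏ p ∈ n.primeFactors, if p < B then K else 1)
          * ∏ p ∈ n.primeFactors, ((p : ℝ) ^ n.factorization p) ^ δ := Finset.prod_mul_distrib
    _ ≤ _ := by
        gcongr
        rw [Finset.prod_ite, Finset.prod_const, Finset.prod_const_one, mul_one]
        refine pow_le_pow_right₀ hK1 ?_
        calc _ ≤ (Finset.range B).card := Finset.card_le_card fun p hp ↦ by
              simpa using (Finset.mem_filter.1 hp).2
          _ = B := Finset.card_range B

/-- The positive and negative divisors of an integer (empty for `0`). -/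
def signedDivisors (N : ℤ) : Finset ℤ :=
  N.natAbs.divisors.image (fun d : ℕ ↦ (d : ℤ)) ∪ N.natAbs.divisors.image (fun d : ℕ ↦ -(d : ℤ))

theorem mem_signedDivisors {N d : ℤ} (hN : N ≠ 0) (h : d ∣ N) : d ∈ signedDivisors N := by
  have hd : d.natAbs ∈ N.natAbs.divisors := by simpa [hN, Int.natAbs_dvd_natAbs] using h
  rcases Int.natAbs_eq d with h | h
  · exact Finset.mem_union_left _ (Finset.mem_image.2 ⟨_, hd, h.symm⟩)
  · exact Finset.mem_union_right _ (Finset.mem_image.2 ⟨_, hd, h.symm⟩)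

theorem card_signedDivisors_le (N : ℤ) :
    (signedDivisors N).card ≤ 2 * N.natAbs.divisors.card := by
  refine (Finset.card_union_le _ _).trans ?_
  rw [two_mul]
  exact add_le_add Finset.card_image_le Finset.card_image_le

theorem card_Icc_neg_floor_le {R : ℝ} (hR : 1 ≤ R) :
    ((Finset.Icc (-⌊R⌋) ⌊R⌋).card : ℝ) ≤ 3 * R := by
  have h0 : 0 ≤ ⌊R⌋ := Int.floor_nonneg.2 (by linarith)
  have h : ((Finset.Icc (-⌊R⌋) ⌊R⌋).card : ℤ) = 2 * ⌊R⌋ + 1 := by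
    rw [Int.card_Icc]; omega
  have h' : ((Finset.Icc (-⌊R⌋) ⌊R⌋).card : ℝ) = 2 * ⌊R⌋ + 1 := by exact_mod_cast h
  rw [h']
  linarith [Int.floor_le R]

theorem mem_Icc_neg_floor {R : ℝ} {n : ℤ} (h : |(n : ℝ)| ≤ R) :
    n ∈ Finset.Icc (-⌊R⌋) ⌊R⌋ := by
  have : |n| ≤ ⌊R⌋ := Int.le_floor.2 (by push_cast; exact h)
  exact Finset.mem_Icc.2 (abs_le.1 this)

/-- **Divisor-bound count.** For every `ε > 0`, `M ≥ 2` and `P ≥ 1`, the number of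
8-tuples `(a₁,…,a₄,b₁,…,b₄)` of nonzero integers with `|aᵢ|, |bᵢ| ≤ M`,
`a₁a₂a₃a₄ = b₁b₂b₃b₄` and `max(|a₁a₂|, |a₃a₄|, |b₁b₂|, |b₃b₄|) ≤ P` is `≪_ε P·M^{2+ε}`. -/
theorem count_equal_products (ε : ℝ) (hε : 0 < ε) :
    ∃ C : ℝ, 0 < C ∧ ∀ M P : ℝ, 2 ≤ M → 1 ≤ P →
      (Nat.card {x : (Fin 4 → ℤ) × (Fin 4 → ℤ) //
          (∀ i, x.1 i ≠ 0 ∧ x.2 i ≠ 0 ∧ |(x.1 i : ℝ)| ≤ M ∧ |(x.2 i : ℝ)| ≤ M) ∧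
          x.1 0 * x.1 1 * x.1 2 * x.1 3 = x.2 0 * x.2 1 * x.2 2 * x.2 3 ∧
          ((max (max |x.1 0 * x.1 1| |x.1 2 * x.1 3|)
              (max |x.2 0 * x.2 1| |x.2 2 * x.2 3|) : ℤ) : ℝ) ≤ P} : ℝ)
        ≤ C * P * M ^ (2 + ε) := by
  obtain ⟨C, hC, hdiv⟩ := Nat.exists_card_divisors_le_rpow (ε / 32) (by positivity)
  refine ⟨27 * (2 * C) ^ 8, by positivity, fun M P hM hP ↦ ?_⟩
  have hM0 : 0 < M := by linarith
  set I : Finset (ℤ × ℤ × ℤ) := (Finset.Icc (-⌊P⌋) ⌊P⌋ ×ˢ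
    Finset.Icc (-⌊M⌋) ⌊M⌋ ×ˢ Finset.Icc (-⌊M⌋) ⌊M⌋).filter
      (fun t ↦ |((t.1 * t.2.1 * t.2.2 : ℤ) : ℝ)| ≤ M ^ 4) with hI
  set F : ℤ × ℤ × ℤ → Finset ((Fin 4 → ℤ) × (Fin 4 → ℤ)) := fun t ↦
    Fintype.piFinset (fun _ ↦ signedDivisors (t.1 * t.2.1 * t.2.2)) ×ˢ
      Fintype.piFinset (fun _ ↦ signedDivisors (t.1 * t.2.1 * t.2.2)) with hF
  have hcardI : (I.card : ℝ) ≤ 27 * P * M ^ 2 := by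
    calc (I.card : ℝ) ≤ (Finset.Icc (-⌊P⌋) ⌊P⌋).card *
          ((Finset.Icc (-⌊M⌋) ⌊M⌋).card * (Finset.Icc (-⌊M⌋) ⌊M⌋).card) := by
          rw [hI]
          refine (Nat.cast_le.2 (Finset.card_filter_le _ _)).trans_eq ?_
          simp only [Finset.card_product, Nat.cast_mul]
      _ ≤ (3 * P) * ((3 * M) * (3 * M)) := by
          have hM1 : 1 ≤ M := by linarith
          gcongr <;> apply card_Icc_neg_floor_le <;> assumption
      _ = _ := by ring
  have hcardF : ∀ t ∈ I, ((F t).card : ℝ) ≤ (2 * C) ^ 8 * M ^ ε := by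
    intro t ht
    have hN := (Finset.mem_filter.1 ht).2
    set N := t.1 * t.2.1 * t.2.2
    have hτ : ((signedDivisors N).card : ℝ) ≤ 2 * C * M ^ (ε / 8) := by
      calc ((signedDivisors N).card : ℝ) ≤ 2 * N.natAbs.divisors.card := by
            exact_mod_cast card_signedDivisors_le N
        _ ≤ 2 * (C * (M ^ 4) ^ (ε / 32)) := by
            refine mul_le_mul_of_nonneg_left ((hdiv _).trans ?_) (by norm_num)
            rw [Nat.cast_natAbs, Int.cast_abs]
            gcongr
        _ = _ := by
            rw [← Real.rpow_natCast, ← Real.rpow_mul hM0.le]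
            ring_nf
    calc ((F t).card : ℝ) = ((signedDivisors N).card : ℝ) ^ 8 := by
          simp only [hF, Finset.card_product, Fintype.card_piFinset_const]
          push_cast
          ring
      _ ≤ (2 * C * M ^ (ε / 8)) ^ 8 := by gcongr
      _ = _ := by
          rw [mul_pow, ← Real.rpow_natCast (M ^ (ε / 8)), ← Real.rpow_mul hM0.le]
          norm_num
  have hsub : ∀ x : (Fin 4 → ℤ) × (Fin 4 → ℤ),
      ((∀ i, x.1 i ≠ 0 ∧ x.2 i ≠ 0 ∧ |(x.1 i : ℝ)| ≤ M ∧ |(x.2 i : ℝ)| ≤ M) ∧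
          x.1 0 * x.1 1 * x.1 2 * x.1 3 = x.2 0 * x.2 1 * x.2 2 * x.2 3 ∧
          ((max (max |x.1 0 * x.1 1| |x.1 2 * x.1 3|)
              (max |x.2 0 * x.2 1| |x.2 2 * x.2 3|) : ℤ) : ℝ) ≤ P) → x ∈ I.biUnion F := by
    rintro ⟨a, b⟩ ⟨hx, hab, hmax⟩
    dsimp only at hx hab hmax
    have hN0 : a 0 * a 1 * a 2 * a 3 ≠ 0 := by simp [(hx _).1]
    have hprod (c : Fin 4 → ℤ) (i : Fin 4) : c i ∣ c 0 * c 1 * c 2 * c 3 := by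
      have := Finset.dvd_prod_of_mem c (Finset.mem_univ i)
      rwa [Fin.prod_univ_four] at this
    refine Finset.mem_biUnion.2 ⟨(a 0 * a 1, a 2, a 3), ?_, ?_⟩
    · refine Finset.mem_filter.2 ⟨Finset.mem_product.2 ⟨mem_Icc_neg_floor ?_,
        Finset.mem_product.2 ⟨mem_Icc_neg_floor (hx 2).2.2.1,
          mem_Icc_neg_floor (hx 3).2.2.1⟩⟩, ?_⟩
      · refine le_trans ?_ hmax
        rw [← Int.cast_abs]
        exact Int.cast_le.2 ((le_max_left _ _).trans (le_max_left _ _))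
      · push_cast
        simp only [abs_mul]
        calc _ ≤ M * M * M * M := by
              gcongr
              exacts [(hx 0).2.2.1, (hx 1).2.2.1, (hx 2).2.2.1, (hx 3).2.2.1]
          _ = M ^ 4 := by ring
    · refine Finset.mem_product.2 ⟨Fintype.mem_piFinset.2 fun i ↦ mem_signedDivisors hN0 (hprod a i),
        Fintype.mem_piFinset.2 fun i ↦ mem_signedDivisors hN0 ?_⟩
      dsimp only
      rw [hab]
      exact hprod b i
  calc _ ≤ ((I.biUnion F).card : ℝ) := by
        rw [← Nat.card_eq_finsetCard]
        exact Nat.cast_le.2 (Nat.card_le_card_of_injective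
          (fun x ↦ (⟨x.1, hsub x.1 x.2⟩ : I.biUnion F))
          fun x y h ↦ Subtype.ext (congrArg (fun z : I.biUnion F ↦ z.1) h))
    _ ≤ ∑ t ∈ I, ((F t).card : ℝ) := by exact_mod_cast Finset.card_biUnion_le
    _ ≤ ∑ t ∈ I, (2 * C) ^ 8 * M ^ ε := Finset.sum_le_sum hcardF
    _ = I.card * ((2 * C) ^ 8 * M ^ ε) := by rw [Finset.sum_const, nsmul_eq_mul]
    _ ≤ 27 * P * M ^ 2 * ((2 * C) ^ 8 * M ^ ε) := by gcongr
    _ = _ := by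
        rw [Real.rpow_add hM0, Real.rpow_two]
        ring
end
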